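/- arXiv:1011.1027 — 7 statements merged into one kernel-verified Lean document; each statement's English description precedes it below -/
import Mathlib

section
/- Let a and b be invertible vectors in X with B(a,a) = B(b,b). Then there is a linear map φ with φ(a) = b which is either a hyperplane reflection or the composition of two hyperplane reflections. More precisely: if B(a-b, a-b) ≠ 0 then φ_{a-b}(a) = b, and if B(a+b, a+b) ≠ 0 then φ_b(φ_{a+b}(a)) = b. -/
/-- The reflection with respect to the hyperplane `H_s = {x : B x s = 0}`,
for an invertible vector `s`: `φ_s x = x - (2 * B x s / B s s) • s`. -/
noncomputable def hreflect {X : Type*} [AddCommGroup X] [Module ℝ X]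
    (B : LinearMap.BilinForm ℝ X) (s x : X) : X :=
  x - (2 * B x s / B s s) • s

noncomputable def hreflectLin {X : Type*} [AddCommGroup X] [Module ℝ X]
    (B : LinearMap.BilinForm ℝ X) (s : X) : X →ₗ[ℝ] X where
  toFun := hreflect B s
  map_add' x y := by
    simp only [hreflect, map_add, LinearMap.add_apply, mul_add, add_div, add_smul]
    abel
  map_smul' c x := by
    simp only [hreflect, map_smul, LinearMap.smul_apply, smul_eq_mul, RingHom.id_apply,
      smul_sub, smul_smul]
    congr 2
    ring

/-- for invertible vectors `a`, `b` with `B a a = B b b`, there is a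
linear map sending `a` to `b` which is either a hyperplane reflection or the
composition of two hyperplane reflections; more precisely, if `a - b` is invertible
then `φ_{a-b} a = b`, and if `a + b` is invertible then `φ_b (φ_{a+b} a) = b`. -/
theorem stmt_1 (X : Type*) [AddCommGroup X] [Module ℝ X] [FiniteDimensional ℝ X]
    (B : LinearMap.BilinForm ℝ X)
    (hsymm : ∀ u v : X, B u v = B v u)
    (hnondeg : ∀ v : X, v ≠ 0 → ∃ w : X, B v w ≠ 0)
    (a b : X) (ha : B a a ≠ 0) (hb : B b b ≠ 0) (hab : B a a = B b b) :
    (∃ φ : X →ₗ[ℝ] X, φ a = b ∧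
      ((∃ s : X, B s s ≠ 0 ∧ ⇑φ = hreflect B s) ∨
       (∃ s₁ s₂ : X, B s₁ s₁ ≠ 0 ∧ B s₂ s₂ ≠ 0 ∧ ⇑φ = hreflect B s₁ ∘ hreflect B s₂))) ∧
    (B (a - b) (a - b) ≠ 0 → hreflect B (a - b) a = b) ∧
    (B (a + b) (a + b) ≠ 0 → hreflect B b (hreflect B (a + b) a) = b) := by
  have h1 : B (a - b) (a - b) ≠ 0 → hreflect B (a - b) a = b := by
    intro h
    have e : 2 * B a (a - b) / B (a - b) (a - b) = 1 := by
      rw [div_eq_one_iff_eq h]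
      simp only [map_sub, LinearMap.sub_apply]
      linarith [hsymm a b]
    rw [hreflect, e]
    module
  have h2 : B (a + b) (a + b) ≠ 0 → hreflect B b (hreflect B (a + b) a) = b := by
    intro h
    have e : 2 * B a (a + b) / B (a + b) (a + b) = 1 := by
      rw [div_eq_one_iff_eq h]
      simp only [map_add, LinearMap.add_apply]
      linarith [hsymm a b]
    have e1 : hreflect B (a + b) a = -b := by
      rw [hreflect, e]
      module
    have e2 : 2 * B (-b) b / B b b = -2 := by
      rw [div_eq_iff hb]
      simp
    rw [e1, hreflect, e2]
    module
  refine ⟨?_, h1, h2⟩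
  by_cases h : B (a - b) (a - b) = 0
  · have h' : B (a + b) (a + b) ≠ 0 := by
      intro h'
      apply ha
      simp only [map_add, LinearMap.add_apply, map_sub, LinearMap.sub_apply] at h h'
      linarith
    exact ⟨hreflectLin B b ∘ₗ hreflectLin B (a + b), h2 h', Or.inr ⟨b, a + b, hb, h', rfl⟩⟩
  · exact ⟨hreflectLin B (a - b), h1 h, Or.inl ⟨a - b, h, rfl⟩⟩
end

section
/- Let T be an orthogonal transformation of ℝ^{p,q} such that for every vector x with B(x,x) ≠ 0, the vector T(x) − x is nonzero and isotropic (B(T(x)−x, T(x)−x) = 0). Then p = q and 2p is a multiple of 4 (equivalently, p is even). -/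
/-- The standard bilinear form of signature `(p, q)` on `ℝ^(p+q)`:
`B x y = ∑_{i < p} x i * y i - ∑_{p ≤ i < p+q} x i * y i`. -/
noncomputable def Bpq (p q : ℕ) : LinearMap.BilinForm ℝ (Fin (p + q) → ℝ) :=
  LinearMap.mk₂ ℝ
    (fun x y => ∑ i : Fin (p + q), (if i.val < p then (1 : ℝ) else -1) * (x i * y i))
    (fun x x' y => by simp [add_mul, mul_add, Finset.sum_add_distrib])
    (fun c x y => by simp [Finset.mul_sum]; congr 1; funext i; ring_nf)
    (fun x y y' => by simp [add_mul, mul_add, Finset.sum_add_distrib])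
    (fun c x y => by simp [Finset.mul_sum]; congr 1; funext i; ring_nf)

theorem Bpq_app (p q : ℕ) (x y : Fin (p + q) → ℝ) : Bpq p q x y =
    ∑ i : Fin (p + q), (if i.val < p then (1 : ℝ) else -1) * (x i * y i) := rfl

theorem Bpq_comm (p q : ℕ) (x y : Fin (p + q) → ℝ) : Bpq p q x y = Bpq p q y x := by
  simp only [Bpq_app, mul_comm (x _)]

theorem Bpq_single (p q : ℕ) (x : Fin (p + q) → ℝ) (i : Fin (p + q)) :
    Bpq p q x (Pi.single i 1) = (if i.val < p then (1 : ℝ) else -1) * x i := by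
  rw [Bpq_app, Finset.sum_eq_single i]
  · simp
  · intro j _ hj
    simp [Pi.single_eq_of_ne hj]
  · simp

theorem Bpq_nondeg (p q : ℕ) (x : Fin (p + q) → ℝ) (h : ∀ y, Bpq p q x y = 0) : x = 0 := by
  funext i
  have := h (Pi.single i 1)
  rw [Bpq_single] at this
  split_ifs at this <;> simpa using this

theorem Bpq_split (p q : ℕ) (x : Fin (p + q) → ℝ) : Bpq p q x x =
    ∑ i : Fin p, x (Fin.castAdd q i) ^ 2 - ∑ i : Fin q, x (Fin.natAdd p i) ^ 2 := by
  rw [Bpq_app, Fin.sum_univ_add]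
  simp [pow_two, sub_eq_add_neg]

theorem Bpq_iso_le_left (p q : ℕ) (W : Submodule ℝ (Fin (p + q) → ℝ))
    (hW : ∀ x ∈ W, Bpq p q x x = 0) : Module.finrank ℝ W ≤ p := by
  have hinj : Function.Injective
      ((LinearMap.funLeft ℝ ℝ (Fin.castAdd q : Fin p → Fin (p + q))).comp W.subtype) := by
    rw [← LinearMap.ker_eq_bot, LinearMap.ker_eq_bot']
    rintro ⟨x, hx⟩ h
    have h1 : ∀ i : Fin p, x (Fin.castAdd q i) = 0 := fun i => congrFun h i
    have h2 := hW x hx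
    rw [Bpq_split] at h2
    simp only [h1] at h2
    have h3 : ∑ i : Fin q, x (Fin.natAdd p i) ^ 2 = 0 := by simpa using h2
    rw [Finset.sum_eq_zero_iff_of_nonneg (fun i _ => sq_nonneg _)] at h3
    ext i
    refine Fin.addCases (fun i => ?_) (fun i => ?_) i
    · exact h1 i
    · simpa using h3 i (Finset.mem_univ _)
  simpa using LinearMap.finrank_le_finrank_of_injective hinj

theorem Bpq_iso_le_right (p q : ℕ) (W : Submodule ℝ (Fin (p + q) → ℝ))
    (hW : ∀ x ∈ W, Bpq p q x x = 0) : Module.finrank ℝ W ≤ q := by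
  have hinj : Function.Injective
      ((LinearMap.funLeft ℝ ℝ (Fin.natAdd p : Fin q → Fin (p + q))).comp W.subtype) := by
    rw [← LinearMap.ker_eq_bot, LinearMap.ker_eq_bot']
    rintro ⟨x, hx⟩ h
    have h1 : ∀ i : Fin q, x (Fin.natAdd p i) = 0 := fun i => congrFun h i
    have h2 := hW x hx
    rw [Bpq_split] at h2
    simp only [h1] at h2
    have h3 : ∑ i : Fin p, x (Fin.castAdd q i) ^ 2 = 0 := by simpa using h2
    rw [Finset.sum_eq_zero_iff_of_nonneg (fun i _ => sq_nonneg _)] at h3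
    ext i
    refine Fin.addCases (fun i => ?_) (fun i => ?_) i
    · simpa using h3 i (Finset.mem_univ _)
    · exact h1 i
  simpa using LinearMap.finrank_le_finrank_of_injective hinj

theorem even_of_skew {n : ℕ} (A : Matrix (Fin n) (Fin n) ℝ) (hA : A.transpose = -A)
    (hd : A.det ≠ 0) : Even n := by
  by_contra hn
  rw [Nat.not_even_iff_odd] at hn
  have h := A.det_transpose
  rw [hA, Matrix.det_neg, Fintype.card_fin, hn.neg_one_pow] at h
  apply hd
  linarith

theorem iso_all (p q : ℕ) (N : (Fin (p + q) → ℝ) →ₗ[ℝ] (Fin (p + q) → ℝ))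
    (h : ∀ x, Bpq p q x x ≠ 0 → Bpq p q (N x) (N x) = 0) (x : Fin (p + q) → ℝ) :
    Bpq p q (N x) (N x) = 0 := by
  by_cases hx : Bpq p q x x = 0
  swap
  · exact h x hx
  by_cases hx0 : x = 0
  · simp [hx0]
  obtain ⟨i, -⟩ := Function.ne_iff.mp hx0
  obtain ⟨y, hy⟩ : ∃ y, Bpq p q y y ≠ 0 := by
    refine ⟨Pi.single i 1, ?_⟩
    rw [Bpq_single]
    split_ifs <;> simp
  have hyN := h y hy
  have hxy := Bpq_comm p q y x
  have hxyN := Bpq_comm p q (N y) (N x)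
  set γ := Bpq p q y y
  set β := Bpq p q x y
  obtain ⟨t, ht0, ht1, ht2⟩ : ∃ t : ℝ, t ≠ 0 ∧ 2 * β + t * γ ≠ 0 ∧ 2 * β - t * γ ≠ 0 := by
    have hpos : 0 < 1 + 2 * |β / γ| := by positivity
    refine ⟨1 + 2 * |β / γ|, hpos.ne', ?_, ?_⟩ <;> intro h0
    · have : 2 * (β / γ) = -(1 + 2 * |β / γ|) := by
        field_simp; linarith
      linarith [neg_abs_le (β / γ)]
    · have : 2 * (β / γ) = (1 + 2 * |β / γ|) := by
        field_simp; linarith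
      linarith [le_abs_self (β / γ)]
  have e1 : ∀ t : ℝ, Bpq p q (x + t • y) (x + t • y) = t * (2 * β + t * γ) := by
    intro t
    simp only [map_add, map_smul, LinearMap.add_apply, LinearMap.smul_apply, smul_eq_mul, hx, hxy]
    ring
  have e2 : ∀ t : ℝ, Bpq p q (N (x + t • y)) (N (x + t • y)) =
      Bpq p q (N x) (N x) + 2 * t * Bpq p q (N x) (N y) := by
    intro t
    simp only [map_add, map_smul, LinearMap.add_apply, LinearMap.smul_apply, smul_eq_mul, hyN, hxyN]
    ring
  have f1 := h (x + t • y) (by rw [e1]; exact mul_ne_zero ht0 ht1)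
  have f2 := h (x + (-t) • y) (by
    rw [e1]; exact mul_ne_zero (neg_ne_zero.mpr ht0) (by intro h0; apply ht2; linarith))
  rw [e2] at f1 f2
  linarith

/-- if `T` is an orthogonal transformation of `ℝ^{p,q}` such that
`T x - x` is nonzero and isotropic for every nonisotropic `x`, then `p = q` and
`2 p` is a multiple of `4`. -/
theorem stmt_3 (p q : ℕ) (T : (Fin (p + q) → ℝ) →ₗ[ℝ] (Fin (p + q) → ℝ))
    (horth : ∀ x y : Fin (p + q) → ℝ, Bpq p q (T x) (T y) = Bpq p q x y)
    (hiso : ∀ x : Fin (p + q) → ℝ, Bpq p q x x ≠ 0 →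
      T x - x ≠ 0 ∧ Bpq p q (T x - x) (T x - x) = 0) :
    p = q ∧ 4 ∣ 2 * p := by
  set N : (Fin (p + q) → ℝ) →ₗ[ℝ] (Fin (p + q) → ℝ) := T - LinearMap.id with hN
  have hNx : ∀ x, N x = T x - x := fun x => rfl
  have hT : ∀ x, T x = x + N x := fun x => by rw [hNx]; abel
  have hall : ∀ x, Bpq p q (N x) (N x) = 0 := iso_all p q N (fun x hx => (hiso x hx).2)
  have hpol : ∀ x y, Bpq p q (N x) (N y) = 0 := by
    intro x y
    have h := hall (x + y)
    simp only [map_add, LinearMap.add_apply, hall] at h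
    have := Bpq_comm p q (N x) (N y)
    linarith
  have hskew : ∀ x y, Bpq p q (N x) y = - Bpq p q (N y) x := by
    intro x y
    have h := horth x y
    rw [hT x, hT y] at h
    simp only [map_add, LinearMap.add_apply, hpol] at h
    have := Bpq_comm p q x (N y)
    linarith
  have hker : ∀ x ∈ LinearMap.ker N, Bpq p q x x = 0 := by
    intro x hx
    by_contra h
    exact (hiso x h).1 hx
  have hran : ∀ x ∈ LinearMap.range N, Bpq p q x x = 0 := by
    rintro _ ⟨x, rfl⟩
    exact hall x
  have hsum := LinearMap.finrank_range_add_finrank_ker N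
  rw [Module.finrank_fin_fun] at hsum
  have k1 := Bpq_iso_le_left p q _ hker
  have k2 := Bpq_iso_le_right p q _ hker
  have r1 := Bpq_iso_le_left p q _ hran
  have r2 := Bpq_iso_le_right p q _ hran
  have hpq : p = q := by omega
  refine ⟨hpq, ?_⟩
  obtain ⟨W, hW⟩ := Submodule.exists_isCompl (LinearMap.ker N)
  have hWd : Module.finrank ℝ W = p := by
    have := Submodule.finrank_add_eq_of_isCompl hW
    rw [Module.finrank_fin_fun] at this
    omega
  let b : Module.Basis (Fin p) ℝ W := Module.finBasisOfFinrankEq ℝ W hWd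
  let ω : LinearMap.BilinForm ℝ W := ((Bpq p q).comp N LinearMap.id).restrict W
  have hω : ∀ v w : W, ω v w = Bpq p q (N v) w := fun v w => rfl
  have hsk : ∀ v w : W, ω v w = - ω w v := fun v w => hskew v w
  have hleft : ∀ v : W, (∀ w, ω v w = 0) → v = 0 := by
    intro v hv
    have : N (v : Fin (p + q) → ℝ) = 0 := by
      apply Bpq_nondeg
      intro y
      have hy : y ∈ LinearMap.ker N ⊔ W := by rw [hW.sup_eq_top]; trivial
      obtain ⟨k, hk, w, hw, rfl⟩ := Submodule.mem_sup.mp hy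
      rw [map_add, hskew _ k, LinearMap.mem_ker.mp hk]
      have := hv ⟨w, hw⟩
      rw [hω] at this
      simpa using this
    have h0 : (v : Fin (p + q) → ℝ) ∈ LinearMap.ker N ⊓ W := ⟨this, v.2⟩
    rw [hW.inf_eq_bot] at h0
    exact Subtype.ext (by simpa using h0)
  have hnd : ω.Nondegenerate := by
    refine ⟨hleft, fun v hv => hleft v fun w => ?_⟩
    rw [hsk, hv, neg_zero]
  have hdet := (LinearMap.BilinForm.nondegenerate_iff_det_ne_zero b).mp hnd
  have hev : Even p := by
    refine even_of_skew _ ?_ hdet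
    ext i j
    simp only [Matrix.transpose_apply, Matrix.neg_apply, LinearMap.BilinForm.toMatrix_apply]
    exact hsk _ _
  obtain ⟨k, hk⟩ := hev
  exact ⟨k, by omega⟩
end

section
/- Let T be an orthogonal transformation of ℝ^{p,q}. Then there exist k ≤ p+q and invertible vectors s_1, s_2, …, s_k in ℝ^{p+q} such that for every vector x, ι(T(x)) = (−1)^k · ι(s_1)·ι(s_2)⋯ι(s_k) · ι(x) · ι(s_k)⁻¹·ι(s_{k-1})⁻¹⋯ι(s_1)⁻¹ in the Clifford algebra of Q. -/
/-- The associated quadratic form `Q x = B x x`. -/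
noncomputable def Qpq (p q : ℕ) : QuadraticForm ℝ (Fin (p + q) → ℝ) :=
  (Bpq p q).toQuadraticMap

namespace CD

open Module

variable {V : Type*} [AddCommGroup V] [Module ℝ V]

/-- Reflection in the vector `s`. -/
noncomputable def refl (B : LinearMap.BilinForm ℝ V) (s : V) : V →ₗ[ℝ] V :=
  LinearMap.transvection ((-2 / B s s) • B s) s

lemma refl_apply (B : LinearMap.BilinForm ℝ V) (s x : V) :
    refl B s x = x + (-2 / B s s * B s x) • s := by
  simp [refl, LinearMap.transvection.apply]

lemma refl_det [FiniteDimensional ℝ V] (B : LinearMap.BilinForm ℝ V) (s : V) (hs : B s s ≠ 0) :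
    LinearMap.det (refl B s) = -1 := by
  rw [refl, LinearMap.transvection.det]
  simp only [LinearMap.smul_apply, smul_eq_mul]
  field_simp
  norm_num

lemma refl_isom (B : LinearMap.BilinForm ℝ V) (hB : ∀ x y, B x y = B y x)
    (s : V) (hs : B s s ≠ 0) (x y : V) : B (refl B s x) (refl B s y) = B x y := by
  simp only [refl_apply, map_add, map_smul, LinearMap.add_apply, LinearMap.smul_apply,
    smul_eq_mul, hB x s]
  field_simp
  ring

lemma refl_refl (B : LinearMap.BilinForm ℝ V)
    (s : V) (hs : B s s ≠ 0) : refl B s * refl B s = 1 := by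
  ext x
  have h : refl B s s = - s := by
    rw [refl_apply, div_mul_cancel₀ _ hs]
    module
  rw [Module.End.mul_apply, refl_apply B s x, map_add, map_smul, h, refl_apply]
  simp

lemma bad [FiniteDimensional ℝ V] (B : LinearMap.BilinForm ℝ V) (hB : ∀ x y, B x y = B y x)
    (hn : B.Nondegenerate) (T : V →ₗ[ℝ] V) (hT : ∀ x y, B (T x) (T y) = B x y)
    (h1 : ∀ x, B x x ≠ 0 → T x ≠ x)
    (h2 : ∀ x, B x x ≠ 0 → B (T x - x) (T x - x) = 0) :
    0 ≤ LinearMap.det T ∧ Even (finrank ℝ V) := by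
  obtain ⟨N, hN⟩ : ∃ N : V →ₗ[ℝ] V, N = T - 1 := ⟨_, rfl⟩
  have hNa : ∀ x, N x = T x - x := by intro x; simp [hN]
  have ha : ∀ x, B (N x) (N x) = 0 := by
    intro x
    by_cases hx : B x x ≠ 0
    · rw [hNa]; exact h2 x hx
    push Not at hx
    by_cases hy : ∃ y, B y y ≠ 0
    · obtain ⟨y, hy⟩ := hy
      have key : ∀ t : ℝ, 1 + |2 * B x y / B y y| ≤ t →
          B (N x) (N x) + 2 * t * B (N x) (N y) + t ^ 2 * B (N y) (N y) = 0 := by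
        intro t ht
        have hne : B (x + t • y) (x + t • y) ≠ 0 := by
          simp only [map_add, map_smul, LinearMap.add_apply, LinearMap.smul_apply,
            smul_eq_mul, hB y x, hx]
          intro h
          have hpos : 0 ≤ |2 * B x y / B y y| := abs_nonneg _
          have htp : t ≠ 0 := by linarith
          have h' : t * (2 * B x y + t * B y y) = 0 := by linear_combination h
          have h'' := (mul_eq_zero.1 h').resolve_left htp
          have : 2 * B x y / B y y = -t := by
            field_simp
            linear_combination h''
          rw [this, abs_neg] at ht
          have := le_abs_self t
          linarith
        have := h2 _ hne
        rw [← hNa] at this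
        simp only [map_add, map_smul, LinearMap.add_apply, LinearMap.smul_apply,
            smul_eq_mul, hB (N y) (N x)] at this
        linear_combination this
      have hpos : 0 ≤ |2 * B x y / B y y| := abs_nonneg _
      set u := 1 + |2 * B x y / B y y|
      have k1 := key u le_rfl
      have k2 := key (2 * u) (by linarith)
      have k3 := key (3 * u) (by linarith)
      linear_combination 3 * k1 - 3 * k2 + k3
    · push Not at hy
      exact hy _
  have hb : ∀ x y, B (N x) (N y) = 0 := by
    intro x y
    have := ha (x + y)
    simp only [map_add, LinearMap.add_apply, ha, hB (N y) (N x)] at this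
    linarith
  have hc : ∀ x y, B (N x) y = - B x (N y) := by
    intro x y
    have h := hb x y
    have h' := hT x y
    simp only [hNa, map_sub, LinearMap.sub_apply] at h ⊢
    linarith
  have hNN : ∀ x, N (N x) = 0 := by
    intro x
    apply hn.1
    intro y
    rw [hc, hb, neg_zero]
  constructor
  · have : T = (1 + (1 / 2 : ℝ) • N) * (1 + (1 / 2 : ℝ) • N) := by
      ext x
      have : T x = x + N x := by rw [hNa]; abel
      simp only [Module.End.mul_apply, LinearMap.add_apply, LinearMap.smul_apply, map_add, map_smul,
        Module.End.one_apply, hNN, this]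
      module
    rw [this, map_mul]
    exact mul_self_nonneg _
  · have hker : ∀ x ∈ LinearMap.ker N, B x x = 0 := by
      intro x hx
      by_contra h
      apply h1 x h
      rw [LinearMap.mem_ker, hNa] at hx
      exact sub_eq_zero.1 hx
    have hle1 : LinearMap.range N ≤ LinearMap.ker N := by
      rintro _ ⟨x, rfl⟩
      exact hNN x
    have hle2 : LinearMap.ker N ≤ B.orthogonal (LinearMap.ker N) := by
      intro x hx y hy
      have h := hker _ (add_mem hx hy)
      simp only [map_add, LinearMap.add_apply, hker _ hx, hker _ hy, hB y x] at h
      change B y x = 0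
      rw [hB y x]
      linarith
    have e1 := Submodule.finrank_mono hle1
    have e2 := Submodule.finrank_mono hle2
    rw [LinearMap.BilinForm.finrank_orthogonal hn] at e2
    have e3 := LinearMap.finrank_range_add_finrank_ker N
    have e4 := Submodule.finrank_le (LinearMap.ker N)
    exact ⟨finrank ℝ (LinearMap.ker N), by omega⟩

lemma prod_isom (B : LinearMap.BilinForm ℝ V) (x : V) (l : List V)
    (hl : ∀ s ∈ l, B s x = 0) : (l.map (refl B)).prod x = x := by
  induction l with
  | nil => simp
  | cons s l ih =>
    simp only [List.map_cons, List.prod_cons, Module.End.mul_apply]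
    rw [ih (fun s hs => hl s (by simp [hs])), refl_apply, hl s (by simp)]
    simp

lemma prod_coe (B : LinearMap.BilinForm ℝ V) (W : Submodule ℝ V) (l : List W) (x : W) :
    ((l.map (fun w : W => (w : V))).map (refl B)).prod (x : V)
      = (((l.map (refl (B.restrict W))).prod x : W) : V) := by
  induction l with
  | nil => simp
  | cons s l ih =>
    simp only [List.map_cons, List.prod_cons, Module.End.mul_apply]
    rw [ih, refl_apply, refl_apply]
    simp

lemma prod_det [FiniteDimensional ℝ V] (B : LinearMap.BilinForm ℝ V) (l : List V)
    (hl : ∀ s ∈ l, B s s ≠ 0) :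
    LinearMap.det (l.map (refl B)).prod = (-1) ^ l.length := by
  induction l with
  | nil => simp
  | cons s l ih =>
    rw [List.map_cons, List.prod_cons, map_mul, ih (fun s hs => hl s (by simp [hs])),
      refl_det _ _ (hl s (by simp)), List.length_cons, pow_succ]
    ring

theorem cartan (n : ℕ) : ∀ (V : Type) [AddCommGroup V] [Module ℝ V] [FiniteDimensional ℝ V]
    (B : LinearMap.BilinForm ℝ V) (_ : ∀ x y, B x y = B y x)
    (_ : B.Nondegenerate) (T : V →ₗ[ℝ] V) (_ : ∀ x y, B (T x) (T y) = B x y)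
    (_ : finrank ℝ V = n),
    ∃ l : List V, l.length ≤ n ∧ (∀ s ∈ l, B s s ≠ 0) ∧ T = (l.map (refl B)).prod := by
  induction n with
  | zero =>
    intro V _ _ _ B hB hn T hT hd
    have : Subsingleton V := finrank_zero_iff.1 hd
    exact ⟨[], by simp, by simp, by ext x; exact Subsingleton.elim _ _⟩
  | succ n ih =>
    intro V _ _ _ B hB hn T hT hd
    -- fixed nonisotropic vector
    have fixed : ∀ (T : V →ₗ[ℝ] V) (_ : ∀ x y, B (T x) (T y) = B x y) (x : V) (_ : B x x ≠ 0)
        (_ : T x = x), ∃ l : List V, l.length ≤ n ∧ (∀ s ∈ l, B s s ≠ 0) ∧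
          T = (l.map (refl B)).prod := by
      intro T hT x hx hTx
      set W := B.orthogonal (Submodule.span ℝ {x}) with hW
      have memW : ∀ y, y ∈ W ↔ B x y = 0 := by
        intro y
        rw [hW, LinearMap.BilinForm.mem_orthogonal_iff]
        constructor
        · intro h
          exact h x (Submodule.mem_span_singleton_self x)
        · intro h z hz
          obtain ⟨c, rfl⟩ := Submodule.mem_span_singleton.1 hz
          simp [h]
      have hTW : ∀ y ∈ W, T y ∈ W := by
        intro y hy
        rw [memW] at hy ⊢
        rw [← hTx, hT, hy]
      have hdW : finrank ℝ W = n := by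
        rw [hW, LinearMap.BilinForm.finrank_orthogonal hn, hd, finrank_span_singleton]
        · simp
        · rintro rfl; simp at hx
      have hrefl : B.IsRefl := fun a b h => by rw [hB, h]
      obtain ⟨l, hl1, hl2, hl3⟩ := ih W (B.restrict W) (fun a b => hB _ _)
        (LinearMap.BilinForm.restrict_nondegenerate_orthogonal_spanSingleton B hn hrefl hx)
        (T.restrict hTW) (fun a b => hT _ _) hdW
      refine ⟨l.map (fun w : W => (w : V)), by simpa using hl1, ?_, ?_⟩
      · intro s hs
        obtain ⟨w, hw, rfl⟩ := List.mem_map.1 hs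
        exact hl2 w hw
      · ext v
        have hfix : ((l.map (fun w : W => (w : V))).map (refl B)).prod x = x := by
          apply prod_isom
          intro s hs
          obtain ⟨w, hw, rfl⟩ := List.mem_map.1 hs
          rw [hB]
          exact (memW _).1 w.2
        have hw : v - (B x v / B x x) • x ∈ W := by
          rw [memW]
          simp only [map_sub, map_smul, smul_eq_mul]
          field_simp
          ring
        have hv : v = (B x v / B x x) • x + (v - (B x v / B x x) • x) := by abel
        have hres := prod_coe B W l ⟨_, hw⟩
        rw [← hl3, LinearMap.restrict_apply] at hres
        rw [hv, map_add, map_add, map_smul, map_smul, hfix, hTx]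
        congr 1
        exact hres.symm
    -- good cases
    have good : ∀ (T : V →ₗ[ℝ] V) (_ : ∀ x y, B (T x) (T y) = B x y)
        (_ : ¬ ((∀ x, B x x ≠ 0 → T x ≠ x) ∧
          (∀ x, B x x ≠ 0 → B (T x - x) (T x - x) = 0))),
        ∃ l : List V, l.length ≤ n + 1 ∧ (∀ s ∈ l, B s s ≠ 0) ∧
          T = (l.map (refl B)).prod := by
      intro T hT hnot
      by_cases h1 : ∀ x, B x x ≠ 0 → T x ≠ x
      · have h2 : ¬ ∀ x, B x x ≠ 0 → B (T x - x) (T x - x) = 0 := fun h => hnot ⟨h1, h⟩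
        push Not at h2
        obtain ⟨x, hx, hs⟩ := h2
        obtain ⟨l, hl1, hl2, hl3⟩ := fixed (refl B (T x - x) * T)
          (fun a b => by
            simp only [Module.End.mul_apply]
            rw [refl_isom B hB _ hs, hT]) x hx (by
            rw [Module.End.mul_apply, refl_apply]
            have e : -2 / B (T x - x) (T x - x) * B (T x - x) (T x) = -1 := by
              have : B (T x - x) (T x - x) = 2 * B (T x - x) (T x) := by
                simp only [map_sub, LinearMap.sub_apply, hT, hB (T x) x]
                ring
              rw [this] at hs ⊢
              have : B (T x - x) (T x) ≠ 0 := by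
                intro h
                rw [h] at hs
                simp at hs
              field_simp
            rw [e]
            simp)
        refine ⟨(T x - x) :: l, by simpa using hl1, ?_, ?_⟩
        · intro s hsl
          rcases List.mem_cons.1 hsl with rfl | h
          · exact hs
          · exact hl2 s h
        · rw [List.map_cons, List.prod_cons, ← hl3, ← mul_assoc, refl_refl B _ hs, one_mul]
      · push Not at h1
        obtain ⟨x, hx, hTx⟩ := h1
        obtain ⟨l, hl1, hl2, hl3⟩ := fixed T hT x hx hTx
        exact ⟨l, by omega, hl2, hl3⟩
    by_cases hcase : ((∀ x, B x x ≠ 0 → T x ≠ x) ∧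
          (∀ x, B x x ≠ 0 → B (T x - x) (T x - x) = 0))
    swap
    · exact good T hT hcase
    obtain ⟨hdet, heven⟩ := bad B hB hn T hT hcase.1 hcase.2
    obtain ⟨y, hy⟩ : ∃ y, B y y ≠ 0 := by
      by_contra hno
      push Not at hno
      have : ∀ x : V, x = 0 := by
        intro x
        apply hn.1
        intro y
        have := hno (x + y)
        simp only [map_add, LinearMap.add_apply, hno, hB y x] at this
        linarith
      have : Subsingleton V := ⟨fun a b => by rw [this a, this b]⟩
      rw [finrank_zero_of_subsingleton] at hd
      omega
    have hiso : ∀ a b, B ((refl B y * T) a) ((refl B y * T) b) = B a b := fun a b => by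
      simp only [Module.End.mul_apply]
      rw [refl_isom B hB _ hy, hT]
    have hT0 : LinearMap.det T ≠ 0 := by
      have hinj : Function.Injective T := by
        rw [injective_iff_map_eq_zero]
        intro a ha
        apply hn.1
        intro b
        rw [← hT, ha]
        simp
      exact (LinearEquiv.ofInjectiveEndo T hinj).isUnit_det'.ne_zero
    have hdetpos : 0 < LinearMap.det T := lt_of_le_of_ne hdet hT0.symm
    have hdetS : LinearMap.det (refl B y * T) = - LinearMap.det T := by
      rw [map_mul, refl_det B y hy]; ring
    obtain ⟨l, hl1, hl2, hl3⟩ := good (refl B y * T) hiso (by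
      rintro ⟨h1, h2⟩
      have := (bad B hB hn _ hiso h1 h2).1
      rw [hdetS] at this
      linarith)
    have hodd : Odd l.length := by
      by_contra h
      rw [Nat.not_odd_iff_even] at h
      have := prod_det B l hl2
      rw [← hl3, hdetS, h.neg_one_pow] at this
      linarith
    refine ⟨y :: l, ?_, ?_, ?_⟩
    · rw [List.length_cons]
      rw [hd] at heven
      rcases hodd with ⟨a, ha⟩
      rcases heven with ⟨b, hb⟩
      omega
    · intro s hsl
      rcases List.mem_cons.1 hsl with rfl | h
      · exact hy
      · exact hl2 s h
    · rw [List.map_cons, List.prod_cons, ← hl3, ← mul_assoc, refl_refl B _ hy, one_mul]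

lemma Bpq_apply (p q : ℕ) (x y : Fin (p + q) → ℝ) :
    Bpq p q x y = ∑ i : Fin (p + q), (if i.val < p then (1 : ℝ) else -1) * (x i * y i) := rfl

lemma Bpq_symm (p q : ℕ) (x y : Fin (p + q) → ℝ) : Bpq p q x y = Bpq p q y x := by
  simp only [Bpq_apply]
  exact Finset.sum_congr rfl fun i _ => by ring

lemma Bpq_left (p q : ℕ) (x : Fin (p + q) → ℝ) (h : ∀ y, Bpq p q x y = 0) : x = 0 := by
  funext i
  have := h (Pi.single i 1)
  rw [Bpq_apply, Finset.sum_eq_single i] at this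
  · simp only [Pi.single_eq_same, mul_one, mul_eq_zero] at this
    rcases this with h | h
    · split_ifs at h <;> norm_num at h
    · exact h
  · intro j _ hj
    simp [Pi.single_eq_of_ne hj]
  · simp

lemma Bpq_nondeg (p q : ℕ) : (Bpq p q).Nondegenerate :=
  ⟨fun x h => Bpq_left p q x h, fun x h => Bpq_left p q x fun y => by rw [Bpq_symm]; exact h y⟩

lemma ι_refl (p q : ℕ) (s x : Fin (p + q) → ℝ) (hs : Bpq p q s s ≠ 0) :
    CliffordAlgebra.ι (Qpq p q) (refl (Bpq p q) s x) =
      - (CliffordAlgebra.ι (Qpq p q) s * CliffordAlgebra.ι (Qpq p q) x *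
        ((Bpq p q s s)⁻¹ • CliffordAlgebra.ι (Qpq p q) s)) := by
  rw [mul_smul_comm, CliffordAlgebra.ι_mul_ι_mul_ι, ← map_smul, ← map_neg]
  congr 1
  have h1 : QuadraticMap.polar (Qpq p q) s x = 2 * Bpq p q s x := by
    rw [Qpq, LinearMap.BilinMap.polar_toQuadraticMap, Bpq_symm p q x s]
    ring
  have h2 : Qpq p q s = Bpq p q s s := rfl
  rw [h1, h2, refl_apply, smul_sub, smul_smul, smul_smul, inv_mul_cancel₀ hs, one_smul, neg_sub,
    sub_eq_add_neg, ← neg_smul]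
  congr 2
  field_simp

lemma ι_prod (p q : ℕ) (l : List (Fin (p + q) → ℝ)) (hl : ∀ s ∈ l, Bpq p q s s ≠ 0)
    (x : Fin (p + q) → ℝ) :
    CliffordAlgebra.ι (Qpq p q) ((l.map (refl (Bpq p q))).prod x) =
      (-1 : CliffordAlgebra (Qpq p q)) ^ l.length *
        ((l.map fun s => CliffordAlgebra.ι (Qpq p q) s).prod * CliffordAlgebra.ι (Qpq p q) x *
          ((l.map fun s => (Bpq p q s s)⁻¹ • CliffordAlgebra.ι (Qpq p q) s).reverse).prod) := by
  induction l with
  | nil => simp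
  | cons s l ih =>
    simp only [List.map_cons, List.prod_cons, Module.End.mul_apply, List.reverse_cons,
      List.prod_append, List.length_cons, List.prod_nil, mul_one]
    rw [ι_refl p q s _ (hl s (by simp)), ih (fun s hs => hl s (by simp [hs]))]
    rcases neg_one_pow_eq_or (CliffordAlgebra (Qpq p q)) l.length with h | h <;>
    · rw [pow_succ, h]
      simp only [one_mul, neg_mul, mul_neg, mul_one, neg_neg, mul_assoc]

end CD


/-- for every orthogonal transformation `T` of `ℝ^{p,q}` there are
`k ≤ p + q` invertible vectors `s_1, …, s_k` such that, in the Clifford algebra,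
`ι (T x) = (-1)^k * ι s_1 ⋯ ι s_k * ι x * (ι s_k)⁻¹ ⋯ (ι s_1)⁻¹` for all `x`,
where `(ι s)⁻¹ = (B s s)⁻¹ • ι s`. -/
theorem stmt_12 (p q : ℕ) (T : (Fin (p + q) → ℝ) →ₗ[ℝ] (Fin (p + q) → ℝ))
    (horth : ∀ x y : Fin (p + q) → ℝ, Bpq p q (T x) (T y) = Bpq p q x y) :
    ∃ (k : ℕ) (s : Fin k → (Fin (p + q) → ℝ)), k ≤ p + q ∧
      (∀ i, Bpq p q (s i) (s i) ≠ 0) ∧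
      ∀ x : Fin (p + q) → ℝ,
        CliffordAlgebra.ι (Qpq p q) (T x) =
          (-1 : CliffordAlgebra (Qpq p q)) ^ k *
            ((List.ofFn fun i => CliffordAlgebra.ι (Qpq p q) (s i)).prod *
              CliffordAlgebra.ι (Qpq p q) x *
              ((List.ofFn fun i => (Bpq p q (s i) (s i))⁻¹ •
                  CliffordAlgebra.ι (Qpq p q) (s i)).reverse).prod) := by
  obtain ⟨l, hl1, hl2, hl3⟩ := CD.cartan (p + q) (Fin (p + q) → ℝ) (Bpq p q) (CD.Bpq_symm p q)
    (CD.Bpq_nondeg p q) T horth (by simp)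
  refine ⟨l.length, l.get, hl1, fun i => hl2 _ (List.get_mem l i), fun x => ?_⟩
  have e : ∀ f : (Fin (p + q) → ℝ) → CliffordAlgebra (Qpq p q),
      (List.ofFn fun i => f (l.get i)) = l.map f := by
    intro f
    rw [← Function.comp_def, ← List.map_ofFn, List.ofFn_get]
  rw [e (fun s => CliffordAlgebra.ι (Qpq p q) s),
    e (fun s => (Bpq p q s s)⁻¹ • CliffordAlgebra.ι (Qpq p q) s), hl3]
  exact CD.ι_prod p q l hl2 x
end

section
/- Let A be a nontrivial associative unital real algebra and f : ℝ^{p+q} → A a linear map such that f(v)·f(v) = B(v,v)·1 for every vector v and such that A is generated as an ℝ-algebra by the image of f. If n = p+q is even, then f is injective and the dimension of A as a real vector space equals 2^n. -/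
section CliffHelpers

theorem cliff_eigen_indep {ι κ A : Type*} [AddCommGroup A] [Module ℝ A]
    (v : ι → A) (hv : ∀ S, v S ≠ 0) (L : κ → A →ₗ[ℝ] A) (χ : κ → ι → ℝ)
    (hL : ∀ i S, L i (v S) = χ i S • v S)
    (hχ : ∀ S T, S ≠ T → ∃ i, χ i S ≠ χ i T) : LinearIndependent ℝ v := by
  classical
  rw [linearIndependent_iff']
  intro s
  induction s using Finset.induction_on with
  | empty => simp
  | insert a s ha ih =>
    intro c hc
    have key : ∀ S ∈ s, c S = 0 := by
      intro S hS
      have hSa : S ≠ a := fun h => ha (h ▸ hS)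
      obtain ⟨i, hi⟩ := hχ S a hSa
      have h1 : ∑ T ∈ s, (c T * (χ i T - χ i a)) • v T = 0 := by
        have h2 := congrArg (fun x => L i x - χ i a • x) hc
        simp only [map_sum, map_smul, hL, Finset.smul_sum, map_zero, smul_zero, sub_zero,
          ← Finset.sum_sub_distrib] at h2
        rw [Finset.sum_insert ha] at h2
        rw [smul_comm, sub_self, zero_add] at h2
        rw [← h2]
        refine Finset.sum_congr rfl fun T _ => ?_
        rw [mul_sub, sub_smul, mul_smul, mul_comm, mul_smul]
      have := ih _ h1 S hS
      exact (mul_eq_zero.1 this).resolve_right (sub_ne_zero.2 hi)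
    intro S hS
    rcases Finset.mem_insert.1 hS with rfl | hS
    · rw [Finset.sum_insert ha, Finset.sum_eq_zero, add_zero] at hc
      · exact (smul_eq_zero.1 hc).resolve_right (hv _)
      · intro T hT
        rw [key T hT, zero_smul]
    · exact key S hS

variable {κ A : Type*} [Ring A] [Algebra ℝ A] (e : κ → A)

theorem cliff_perm (anti : ∀ i j, i ≠ j → e i * e j = -(e j * e i)) {l l' : List κ}
    (h : l.Perm l') : ∃ c : ℝ, (l.map e).prod = c • (l'.map e).prod := by
  induction h with
  | nil => exact ⟨1, by simp⟩
  | cons x _ ih =>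
    obtain ⟨c, hc⟩ := ih
    exact ⟨c, by simp [hc]⟩
  | swap x y l =>
    by_cases h : y = x
    · subst h
      exact ⟨1, by simp⟩
    · refine ⟨-1, ?_⟩
      simp only [List.map_cons, List.prod_cons, ← mul_assoc]
      rw [anti y x h]
      simp
  | trans _ _ ih1 ih2 =>
    obtain ⟨c, hc⟩ := ih1
    obtain ⟨d, hd⟩ := ih2
    exact ⟨c * d, by rw [hc, hd, mul_smul]⟩

theorem cliff_comm_notMem (anti : ∀ i j, i ≠ j → e i * e j = -(e j * e i)) (i : κ) (l : List κ)
    (h : i ∉ l) : e i * (l.map e).prod = ((-1 : ℝ) ^ l.length) • ((l.map e).prod * e i) := by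
  induction l with
  | nil => simp
  | cons a l ih =>
    simp only [List.mem_cons, not_or] at h
    simp only [List.map_cons, List.prod_cons, List.length_cons]
    rw [← mul_assoc, anti i a h.1, neg_mul, mul_assoc, ih h.2, pow_succ]
    simp [mul_assoc]

theorem cliff_comm_mem (anti : ∀ i j, i ≠ j → e i * e j = -(e j * e i)) (i : κ) (l : List κ)
    (hl : l.Nodup) (h : i ∈ l) :
    e i * (l.map e).prod = (-(-1 : ℝ) ^ l.length) • ((l.map e).prod * e i) := by
  induction l with
  | nil => simp at h
  | cons a l ih =>
    simp only [List.map_cons, List.prod_cons, List.length_cons]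
    rw [List.nodup_cons] at hl
    by_cases hia : i = a
    · subst hia
      rw [mul_assoc, cliff_comm_notMem e anti i l hl.1, pow_succ]
      have hs : (-1 : ℝ) ^ l.length * (-1 : ℝ) ^ l.length = 1 := by
        rw [← mul_pow]; simp
      have h2 : (l.map e).prod * e i = (-1 : ℝ) ^ l.length • (e i * (l.map e).prod) := by
        rw [cliff_comm_notMem e anti i l hl.1, smul_smul, hs, one_smul]
      rw [← cliff_comm_notMem e anti i l hl.1, h2]
      simp [smul_smul, hs]
    · have h' : i ∈ l := (List.mem_cons.1 h).resolve_left hia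
      rw [← mul_assoc, anti i a hia, neg_mul, mul_assoc, ih hl.2 h', pow_succ]
      simp [mul_assoc]

noncomputable def cliffMon (S : Finset κ) : A := (S.toList.map e).prod

theorem cliffMon_ne_zero (hA : (1 : A) ≠ 0) (ε : κ → ℝ) (hε : ∀ i, ε i ≠ 0)
    (he : ∀ i, e i * e i = algebraMap ℝ A (ε i)) (S : Finset κ) : cliffMon e S ≠ 0 := by
  have : Nontrivial A := ⟨1, 0, hA⟩
  unfold cliffMon
  generalize S.toList = l
  induction l with
  | nil => simp
  | cons a l ih =>
    intro h
    simp only [List.map_cons, List.prod_cons] at h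
    have h2 := congrArg (e a * ·) h
    simp only [← mul_assoc, he, mul_zero, ← Algebra.smul_def] at h2
    exact ih ((smul_eq_zero.1 h2).resolve_left (hε a))

theorem cliffMon_mul [DecidableEq κ] (anti : ∀ i j, i ≠ j → e i * e j = -(e j * e i)) (ε : κ → ℝ)
    (he : ∀ i, e i * e i = algebraMap ℝ A (ε i)) (i : κ) (S : Finset κ) :
    ∃ (c : ℝ) (T : Finset κ), e i * cliffMon e S = c • cliffMon e T := by
  unfold cliffMon
  by_cases h : i ∈ S
  · have hp : S.toList.Perm (i :: (S.erase i).toList) := by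
      have := Finset.toList_insert (Finset.notMem_erase i S)
      rwa [Finset.insert_erase h] at this
    obtain ⟨c, hc⟩ := cliff_perm e anti hp
    refine ⟨c * ε i, S.erase i, ?_⟩
    rw [hc, List.map_cons, List.prod_cons, mul_smul_comm, ← mul_assoc, he, ← Algebra.smul_def,
      mul_smul]
  · obtain ⟨c, hc⟩ := cliff_perm e anti (Finset.toList_insert h).symm
    exact ⟨c, insert i S, by rw [← hc, List.map_cons, List.prod_cons]⟩

theorem cliffMon_span [DecidableEq κ] (anti : ∀ i j, i ≠ j → e i * e j = -(e j * e i)) (ε : κ → ℝ)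
    (he : ∀ i, e i * e i = algebraMap ℝ A (ε i))
    (hgen : Algebra.adjoin ℝ (Set.range e) = ⊤) :
    Submodule.span ℝ (Set.range (cliffMon e)) = ⊤ := by
  set W := Submodule.span ℝ (Set.range (cliffMon e)) with hW
  have key : ∀ a ∈ Algebra.adjoin ℝ (Set.range e), ∀ x ∈ W, a * x ∈ W := by
    intro a ha
    induction ha using Algebra.adjoin_induction with
    | mem a ha =>
      obtain ⟨i, rfl⟩ := ha
      intro x hx
      induction hx using Submodule.span_induction with
      | mem x hx =>
        obtain ⟨S, rfl⟩ := hx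
        obtain ⟨c, T, h⟩ := cliffMon_mul e anti ε he i S
        rw [h]
        exact W.smul_mem _ (Submodule.subset_span ⟨T, rfl⟩)
      | zero => simp
      | add x y _ _ h1 h2 => rw [mul_add]; exact W.add_mem h1 h2
      | smul c x _ h => rw [mul_smul_comm]; exact W.smul_mem _ h
    | algebraMap r =>
      intro x hx
      rw [← Algebra.smul_def]
      exact W.smul_mem _ hx
    | add a b _ _ h1 h2 =>
      intro x hx
      rw [add_mul]
      exact W.add_mem (h1 x hx) (h2 x hx)
    | mul a b _ _ h1 h2 =>
      intro x hx
      rw [mul_assoc]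
      exact h1 _ (h2 x hx)
  rw [eq_top_iff]
  intro a _
  have h1 : (1 : A) ∈ W := Submodule.subset_span ⟨∅, by simp [cliffMon]⟩
  have := key a (by rw [hgen]; trivial) 1 h1
  rwa [mul_one] at this

theorem cliff_sep [Fintype κ] [DecidableEq κ] (hev : Even (Fintype.card κ)) (ε : κ → ℝ)
    (hε : ∀ i, ε i ≠ 0) (S T : Finset κ) (hST : S ≠ T) :
    ∃ i, ((if i ∈ S then -(-1 : ℝ) ^ S.card else (-1 : ℝ) ^ S.card) * ε i) ≠
      ((if i ∈ T then -(-1 : ℝ) ^ T.card else (-1 : ℝ) ^ T.card) * ε i) := by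
  by_contra hcon
  push Not at hcon
  have h : ∀ i, (if i ∈ S then -(-1 : ℝ) ^ S.card else (-1 : ℝ) ^ S.card) =
      (if i ∈ T then -(-1 : ℝ) ^ T.card else (-1 : ℝ) ^ T.card) :=
    fun i => mul_right_cancel₀ (hε i) (hcon i)
  have n1 : ¬ ((-1 : ℝ) = 1) := by norm_num
  have n2 : ¬ ((1 : ℝ) = -1) := by norm_num
  by_cases hp : (-1 : ℝ) ^ S.card = (-1 : ℝ) ^ T.card
  · apply hST
    ext i
    have hi := h i
    rw [hp] at hi
    rcases neg_one_pow_eq_or ℝ T.card with h1 | h1 <;> rw [h1] at hi <;>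
      by_cases a : i ∈ S <;> by_cases b : i ∈ T <;> simp_all
  · have hT : T = Sᶜ := by
      ext i
      have hi := h i
      rw [Finset.mem_compl]
      by_cases a : i ∈ S <;> by_cases b : i ∈ T <;> simp_all
    apply hp
    have hc : S.card + T.card = Fintype.card κ := by rw [hT]; exact Finset.card_add_card_compl S
    have : (-1 : ℝ) ^ (S.card + T.card) = 1 := by rw [hc]; exact hev.neg_one_pow
    rw [pow_add] at this
    rcases neg_one_pow_eq_or ℝ T.card with h1 | h1 <;> rw [h1] at this ⊢ <;> linarith

theorem cliff_finrank [Fintype κ] [DecidableEq κ] (hA : (1 : A) ≠ 0)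
    (hev : Even (Fintype.card κ)) (ε : κ → ℝ) (hε : ∀ i, ε i ≠ 0)
    (anti : ∀ i j, i ≠ j → e i * e j = -(e j * e i))
    (he : ∀ i, e i * e i = algebraMap ℝ A (ε i))
    (hgen : Algebra.adjoin ℝ (Set.range e) = ⊤) :
    Module.finrank ℝ A = 2 ^ Fintype.card κ := by
  have li : LinearIndependent ℝ (cliffMon e) := by
    refine cliff_eigen_indep _ (cliffMon_ne_zero e hA ε hε he)
      (fun i => (LinearMap.mulLeft ℝ (e i)).comp (LinearMap.mulRight ℝ (e i)))
      (fun i S => (if i ∈ S then -(-1 : ℝ) ^ S.card else (-1 : ℝ) ^ S.card) * ε i) ?_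
      (cliff_sep hev ε hε)
    intro i S
    simp only [LinearMap.comp_apply, LinearMap.mulLeft_apply, LinearMap.mulRight_apply]
    rw [← mul_assoc]
    have : e i * cliffMon e S =
        (if i ∈ S then -(-1 : ℝ) ^ S.card else (-1 : ℝ) ^ S.card) • (cliffMon e S * e i) := by
      unfold cliffMon
      split_ifs with h
      · rw [cliff_comm_mem e anti i _ S.nodup_toList (by simpa using h), Finset.length_toList]
      · rw [cliff_comm_notMem e anti i _ (by simpa using h), Finset.length_toList]
    rw [this, smul_mul_assoc, mul_assoc, he, ← Algebra.commutes, ← Algebra.smul_def, mul_smul]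
  have b := Module.Basis.mk li (cliffMon_span e anti ε he hgen).ge
  rw [Module.finrank_eq_card_basis b, Fintype.card_finset]

end CliffHelpers

/-- if `A` is a nontrivial associative unital real algebra, generated
by the image of a linear map `f : ℝ^(p+q) → A` satisfying `f v * f v = B v v • 1`,
and `n = p + q` is even, then `f` is injective and `dim_ℝ A = 2 ^ n`. -/
theorem stmt_13 (p q : ℕ) (A : Type*) [Ring A] [Algebra ℝ A] (hA : (1 : A) ≠ 0)
    (f : (Fin (p + q) → ℝ) →ₗ[ℝ] A)
    (hsq : ∀ v : Fin (p + q) → ℝ, f v * f v = algebraMap ℝ A (Bpq p q v v))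
    (hgen : Algebra.adjoin ℝ (Set.range ⇑f) = ⊤)
    (heven : Even (p + q)) :
    Function.Injective ⇑f ∧ Module.finrank ℝ A = 2 ^ (p + q) := by
  have hpol : ∀ v w, f v * f w + f w * f v = algebraMap ℝ A (2 * Bpq p q v w) := by
    intro v w
    have h := hsq (v + w)
    have hsym : Bpq p q w v = Bpq p q v w := by
      simp [Bpq, LinearMap.mk₂_apply, mul_comm]
    simp only [map_add, LinearMap.add_apply, add_mul, mul_add, hsq, hsym] at h
    rw [two_mul, map_add]
    have h' := sub_eq_zero.2 h
    rw [← sub_eq_zero, ← h']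
    abel
  have hB : ∀ v i, Bpq p q v (Pi.single i 1) = (if i.val < p then (1 : ℝ) else -1) * v i := by
    intro v i
    simp only [Bpq, LinearMap.mk₂_apply]
    rw [Finset.sum_eq_single i]
    · rw [Pi.single_eq_same, mul_one]
    · intro j _ hj
      rw [Pi.single_eq_of_ne hj, mul_zero, mul_zero]
    · simp
  have : Nontrivial A := ⟨1, 0, hA⟩
  have hinj0 := (algebraMap ℝ A).injective
  have hε : ∀ i : Fin (p + q), (if i.val < p then (1 : ℝ) else -1) ≠ 0 := by
    intro i; split_ifs <;> norm_num
  refine ⟨?_, ?_⟩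
  · rw [← LinearMap.ker_eq_bot, LinearMap.ker_eq_bot']
    intro v hv
    ext i
    have h := hpol v (Pi.single i 1)
    rw [hv, zero_mul, mul_zero, add_zero, hB] at h
    have h2 := hinj0 ((map_zero _).trans h)
    have h3 := (mul_eq_zero.1 h2.symm).resolve_left two_ne_zero
    exact (mul_eq_zero.1 h3).resolve_left (hε i)
  · have := cliff_finrank (fun i => f (Pi.single i 1)) hA (by simpa using heven)
      (fun i => if i.val < p then (1 : ℝ) else -1) hε ?_ ?_ ?_
    · simpa using this
    · intro i j hij
      have h := hpol (Pi.single i 1) (Pi.single j 1)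
      rw [hB, Pi.single_eq_of_ne hij.symm, mul_zero, mul_zero, map_zero] at h
      exact eq_neg_of_add_eq_zero_left h
    · intro i
      rw [hsq, hB, Pi.single_eq_same, mul_one]
    · rw [eq_top_iff, ← hgen]
      apply Algebra.adjoin_le
      rintro _ ⟨v, rfl⟩
      rw [← Finset.univ_sum_single v, map_sum]
      refine Subalgebra.sum_mem _ fun i _ => ?_
      have : Pi.single i (v i) = v i • (Pi.single i 1 : Fin (p + q) → ℝ) := by
        rw [← Pi.single_smul]; simp
      rw [this, map_smul]
      exact Subalgebra.smul_mem _ (Algebra.subset_adjoin (Set.mem_range_self i)) _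
end

section
/- Let A be a nontrivial associative unital real algebra and f : ℝ^{p+q} → A an injective linear map such that f(v)·f(v) = B(v,v)·1 for every vector v and such that A is generated as an ℝ-algebra by the image of f. Let n = p+q be odd and suppose the product f(e_1)·f(e_2)⋯f(e_n) of the images of the standard basis vectors equals λ·1 for some real λ. Then λ = 1 or λ = −1, p − q ≡ 1 (mod 4), and the dimension of A as a real vector space equals 2^{n−1}. -/
set_option linter.unusedSectionVars false

section helpers
variable {n : ℕ} {A : Type*} [Ring A] [Algebra ℝ A]

/-- equality up to sign -/
def PMEq (x y : A) : Prop := x = y ∨ x = -y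

lemma PMEq.refl' (x : A) : PMEq x x := Or.inl rfl

lemma PMEq.symm' {x y : A} (h : PMEq x y) : PMEq y x := by
  rcases h with rfl | rfl
  · exact Or.inl rfl
  · exact Or.inr (neg_neg y).symm

lemma PMEq.trans' {x y z : A} (h : PMEq x y) (h' : PMEq y z) : PMEq x z := by
  rcases h with rfl | rfl <;> rcases h' with rfl | rfl <;> simp [PMEq]

lemma PMEq.mul' {x y z w : A} (h : PMEq x y) (h' : PMEq z w) : PMEq (x * z) (y * w) := by
  rcases h with rfl | rfl <;> rcases h' with rfl | rfl <;> simp [PMEq]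

lemma PMEq.mem' {x y : A} (h : PMEq x y) (W : Submodule ℝ A) (hy : y ∈ W) : x ∈ W := by
  rcases h with rfl | rfl
  · exact hy
  · exact W.neg_mem hy

/-- product of generators along a list -/
def lpr (g : Fin n → A) (l : List (Fin n)) : A := (l.map g).prod

variable (g : Fin n → A) (ε : Fin n → ℝ)
  (hε : ∀ i, ε i = 1 ∨ ε i = -1)
  (hg : ∀ i, g i * g i = algebraMap ℝ A (ε i))
  (hc : ∀ i j, i ≠ j → g i * g j = -(g j * g i))

lemma lpr_cons (i : Fin n) (l : List (Fin n)) : lpr g (i :: l) = g i * lpr g l := by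
  simp [lpr]

lemma lpr_append (l l' : List (Fin n)) : lpr g (l ++ l') = lpr g l * lpr g l' := by
  simp [lpr]

include hε hg in
lemma sq_pm (i : Fin n) : PMEq (g i * g i) 1 := by
  rw [hg]
  rcases hε i with h | h <;> rw [h] <;> simp [PMEq]

include hc in
lemma lpr_comm (i : Fin n) (l : List (Fin n)) :
    g i * lpr g l = ((-1 : ℝ) ^ (l.length + l.count i)) • (lpr g l * g i) := by
  induction l with
  | nil => simp [lpr]
  | cons a l ih =>
    rw [lpr_cons]
    by_cases h : a = i
    · subst h
      rw [mul_assoc, ih, List.count_cons_self, List.length_cons, mul_smul_comm]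
      congr 1
      ring
    · rw [List.count_cons_of_ne h, List.length_cons, ← mul_assoc, hc i a (Ne.symm h), neg_mul,
        mul_assoc, ih, mul_smul_comm, mul_assoc, ← neg_smul]
      congr 1
      ring

include hc in
lemma lpr_perm {l l' : List (Fin n)} (h : l.Perm l') : PMEq (lpr g l) (lpr g l') := by
  induction h with
  | nil => exact PMEq.refl' _
  | cons x _ ih => rw [lpr_cons, lpr_cons]; exact (PMEq.refl' _).mul' ih
  | swap x y l =>
    rw [lpr_cons, lpr_cons, lpr_cons, lpr_cons, ← mul_assoc, ← mul_assoc]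
    by_cases h : x = y
    · subst h; exact PMEq.refl' _
    · rw [hc x y h]; right; simp
  | trans _ _ h1 h2 => exact h1.trans' h2

include hε hg hc in
lemma lpr_sq_pm (l : List (Fin n)) : PMEq (lpr g l * lpr g l) 1 := by
  induction l with
  | nil => simp [lpr, PMEq]
  | cons a l ih =>
    have h : PMEq (lpr g (a :: l)) (lpr g l * g a) := by
      rw [lpr_cons, lpr_comm g hc]
      rcases neg_one_pow_eq_or ℝ (l.length + l.count a) with h | h <;> rw [h] <;> simp [PMEq]
    have h2 := h.mul' (PMEq.refl' (lpr g (a :: l)))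
    rw [lpr_cons] at h2 ⊢
    refine h2.trans' ?_
    rw [mul_assoc, ← mul_assoc (g a)]
    have h3 := (PMEq.refl' (lpr g l)).mul' ((sq_pm g ε hε hg a).mul' (PMEq.refl' (lpr g l)))
    rw [one_mul] at h3
    exact h3.trans' ih

include hg hc in
lemma lpr_sq (l : List (Fin n)) (hl : l.Nodup) : lpr g l * lpr g l =
    algebraMap ℝ A ((-1) ^ (l.length * (l.length - 1) / 2) * (l.map ε).prod) := by
  induction l with
  | nil => simp [lpr]
  | cons a l ih =>
    rw [List.nodup_cons] at hl
    have h1 : lpr g l * g a = ((-1 : ℝ) ^ l.length) • (g a * lpr g l) := by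
      rw [lpr_comm g hc, List.count_eq_zero_of_not_mem hl.1, smul_smul, add_zero, ← mul_pow]
      simp
    have e : (l.length + 1) * (l.length + 1 - 1) / 2 = l.length * (l.length - 1) / 2 + l.length := by
      rw [← Nat.choose_two_right, ← Nat.choose_two_right, Nat.choose_succ_succ]
      simp [add_comm]
    calc lpr g (a :: l) * lpr g (a :: l) = g a * (lpr g l * g a) * lpr g l := by
          rw [lpr_cons]; simp only [mul_assoc]
      _ = (-1 : ℝ) ^ l.length • ((g a * g a) * (lpr g l * lpr g l)) := by
          rw [h1]; simp only [mul_smul_comm, smul_mul_assoc, mul_assoc]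
      _ = _ := by
          rw [hg, ih hl.2, ← map_mul, Algebra.smul_def, ← map_mul, List.length_cons, e,
            List.map_cons, List.prod_cons, pow_add]
          congr 1
          ring

/-- product over a finset -/
noncomputable def spr (S : Finset (Fin n)) : A := lpr g S.toList

include hε hg hc in
lemma g_mul_sp (i : Fin n) (S : Finset (Fin n)) : ∃ T, PMEq (g i * spr g S) (spr g T) := by
  by_cases h : i ∈ S
  · refine ⟨S.erase i, ?_⟩
    have h1 : PMEq (spr g S) (g i * spr g (S.erase i)) := by
      unfold spr
      rw [← lpr_cons]
      apply lpr_perm g hc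
      conv_lhs => rw [← Finset.insert_erase h]
      exact Finset.toList_insert (Finset.notMem_erase i S)
    have h2 := (PMEq.refl' (g i)).mul' h1
    rw [← mul_assoc] at h2
    have h3 := (sq_pm g ε hε hg i).mul' (PMEq.refl' (spr g (S.erase i)))
    rw [one_mul] at h3
    exact h2.trans' h3
  · refine ⟨insert i S, ?_⟩
    unfold spr
    rw [← lpr_cons]
    exact lpr_perm g hc (Finset.toList_insert h).symm

include hε hg hc in
lemma lpr_sp (l : List (Fin n)) : ∃ T, PMEq (lpr g l) (spr g T) := by
  induction l with
  | nil => exact ⟨∅, by simp [lpr, spr, PMEq]⟩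
  | cons a l ih =>
    obtain ⟨T, hT⟩ := ih
    obtain ⟨U, hU⟩ := g_mul_sp g ε hε hg hc a T
    exact ⟨U, by rw [lpr_cons]; exact ((PMEq.refl' _).mul' hT).trans' hU⟩

include hε hg hc in
lemma span_sp (hgen : Algebra.adjoin ℝ (Set.range g) = ⊤) :
    Submodule.span ℝ (Set.range (spr g)) = ⊤ := by
  rw [eq_top_iff, ← Algebra.top_toSubmodule, ← hgen, Algebra.adjoin_eq_span, Submodule.span_le]
  intro x hx
  have : ∃ l, x = lpr g l := by
    induction hx using Submonoid.closure_induction with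
    | mem x hx => obtain ⟨i, rfl⟩ := hx; exact ⟨[i], by simp [lpr]⟩
    | one => exact ⟨[], by simp [lpr]⟩
    | mul x y _ _ hx hy =>
      obtain ⟨l, rfl⟩ := hx
      obtain ⟨l', rfl⟩ := hy
      exact ⟨l ++ l', (lpr_append g l l').symm⟩
  obtain ⟨l, rfl⟩ := this
  obtain ⟨T, hT⟩ := lpr_sp g ε hε hg hc l
  exact hT.mem' _ (Submodule.subset_span ⟨T, rfl⟩)

include hε hg hc in
lemma span_even (hn : Odd n) (hgen : Algebra.adjoin ℝ (Set.range g) = ⊤) (lam : ℝ)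
    (hl : lpr g (List.finRange n) = algebraMap ℝ A lam) :
    Submodule.span ℝ (Set.range (fun S : {S : Finset (Fin n) // Even S.card} => spr g S.1)) = ⊤ := by
  rw [eq_top_iff, ← span_sp g ε hε hg hc hgen, Submodule.span_le]
  rintro _ ⟨S, rfl⟩
  by_cases hS : Even S.card
  · exact Submodule.subset_span ⟨⟨S, hS⟩, rfl⟩
  · have hS' : Even Sᶜ.card := by
      have := Finset.card_add_card_compl S
      rw [Fintype.card_fin] at this
      rw [← this, Nat.odd_add'] at hn
      rw [Nat.not_even_iff_odd] at hS
      by_contra h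
      rw [Nat.not_even_iff_odd] at h
      exact (Nat.not_even_iff_odd.2 hS) (hn.1 h)
    have hmem : spr g Sᶜ ∈ Submodule.span ℝ
        (Set.range (fun S : {S : Finset (Fin n) // Even S.card} => spr g S.1)) :=
      Submodule.subset_span ⟨⟨Sᶜ, hS'⟩, rfl⟩
    have h1 : PMEq (spr g S * spr g Sᶜ) (algebraMap ℝ A lam) := by
      rw [← hl, spr, spr, ← lpr_append]
      apply lpr_perm g hc
      rw [List.perm_ext_iff_of_nodup]
      · intro a
        simp [em]
      · rw [List.nodup_append]
        refine ⟨S.nodup_toList, Sᶜ.nodup_toList, ?_⟩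
        intro a ha b hb hab
        subst hab
        simp at ha hb
        exact hb ha
      · exact List.nodup_finRange n
    have h2 := h1.mul' (PMEq.refl' (spr g Sᶜ))
    rw [mul_assoc, ← Algebra.smul_def] at h2
    have h3 := (PMEq.refl' (spr g S)).mul' (lpr_sq_pm g ε hε hg hc Sᶜ.toList)
    rw [mul_one] at h3
    exact (h3.symm'.trans' h2).mem' _ (Submodule.smul_mem _ _ hmem)

include hε hg hc in
lemma indep_even (hA : (1 : A) ≠ 0) :
    LinearIndependent ℝ (fun S : {S : Finset (Fin n) // Even S.card} => spr g S.1) := by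
  let T : Module.End ℝ A := ∑ i : Fin n, ((2 : ℝ) ^ (i : ℕ) * ε i) •
    (LinearMap.mulLeft ℝ (g i) ∘ₗ LinearMap.mulRight ℝ (g i))
  let μ : {S : Finset (Fin n) // Even S.card} → ℝ :=
    fun S => ∑ i : Fin n, (2 : ℝ) ^ (i : ℕ) * (if i ∈ S.1 then -1 else 1)
  have hμ : Function.Injective μ := by
    intro S S' h
    have key : ∀ S, μ S = (∑ i : Fin n, (2 : ℝ) ^ (i : ℕ)) -
        2 * ((∑ i ∈ S.1.map Fin.valEmbedding, 2 ^ i : ℕ) : ℝ) := by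
      intro S
      rw [Finset.sum_map]
      push_cast
      rw [Finset.mul_sum, ← Finset.sum_filter_add_sum_filter_not Finset.univ (· ∈ S.1)]
      simp only [μ]
      rw [← Finset.sum_filter_add_sum_filter_not Finset.univ (· ∈ S.1)
        (fun i : Fin n => (2 : ℝ) ^ (i : ℕ) * (if i ∈ S.1 then -1 else 1))]
      rw [Finset.sum_congr rfl (g := fun i : Fin n => -(2 : ℝ) ^ (i : ℕ))
        (by intro i hi; simp at hi; simp [hi])]
      rw [Finset.sum_congr (s₁ := Finset.univ.filter (· ∉ S.1)) rfl
        (g := fun i : Fin n => (2 : ℝ) ^ (i : ℕ))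
        (by intro i hi; simp at hi; simp [hi])]
      simp [← Finset.mul_sum]
      ring
    rw [key, key] at h
    have h2 : (∑ i ∈ S.1.map Fin.valEmbedding, 2 ^ i : ℕ) =
        ∑ i ∈ S'.1.map Fin.valEmbedding, 2 ^ i := by
      have : ((∑ i ∈ S.1.map Fin.valEmbedding, 2 ^ i : ℕ) : ℝ) =
        ((∑ i ∈ S'.1.map Fin.valEmbedding, 2 ^ i : ℕ) : ℝ) := by linarith
      exact_mod_cast this
    have h3 := Finset.geomSum_injective le_rfl h2
    exact Subtype.ext (Finset.map_injective _ h3)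
  refine Module.End.eigenvectors_linearIndependent' T μ hμ _ ?_
  intro S
  rw [Module.End.hasEigenvector_iff, Module.End.mem_eigenspace_iff]
  constructor
  · simp only [T, μ, LinearMap.sum_apply, Finset.sum_smul]
    refine Finset.sum_congr rfl fun i _ => ?_
    simp only [LinearMap.smul_apply, LinearMap.comp_apply, LinearMap.mulLeft_apply,
      LinearMap.mulRight_apply]
    have hcount : (S.1.toList).count i = if i ∈ S.1 then 1 else 0 := by
      rw [List.Nodup.count (Finset.nodup_toList _)]
      simp
    have hεε : ε i * ε i = 1 := by rcases hε i with h | h <;> rw [h] <;> norm_num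
    rw [← mul_assoc, spr, lpr_comm g hc, smul_mul_assoc, mul_assoc, hg, ← Algebra.commutes,
      ← Algebra.smul_def, smul_smul, smul_smul, hcount, Finset.length_toList, pow_add,
      S.2.neg_one_pow]
    congr 1
    split_ifs
    · linear_combination (-(2 : ℝ) ^ (i : ℕ)) * hεε
    · linear_combination ((2 : ℝ) ^ (i : ℕ)) * hεε
  · intro h0
    have := lpr_sq_pm g ε hε hg hc S.1.toList
    rw [show lpr g S.1.toList = 0 from h0] at this
    rcases this with h | h
    · simp at h; exact hA h.symm
    · simp at h; exact hA h

lemma card_even (hn : Odd n) :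
    Fintype.card {S : Finset (Fin n) // Even S.card} = 2 ^ (n - 1) := by
  have h1 : Fintype.card {S : Finset (Fin n) // Even S.card} =
      Fintype.card {S : Finset (Fin n) // ¬ Even S.card} := by
    refine Fintype.card_congr ((compl_involutive.toPerm (compl : Finset (Fin n) → _)).subtypeEquiv ?_)
    intro S
    have := Finset.card_add_card_compl S
    rw [Fintype.card_fin] at this
    rw [← this, Nat.odd_add'] at hn
    simp only [Function.Involutive.coe_toPerm, Nat.not_even_iff_odd]
    exact hn.symm
  have h2 := Fintype.card_subtype_compl (fun S : Finset (Fin n) => Even S.card)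
  have h3 := Fintype.card_subtype_le (fun S : Finset (Fin n) => Even S.card)
  rw [← h1] at h2
  rw [Fintype.card_finset, Fintype.card_fin] at h2 h3
  obtain ⟨m, rfl⟩ := hn
  rw [pow_succ] at h2 h3
  simp only [Nat.add_sub_cancel]
  omega

end helpers

/-- if `A` is a nontrivial associative unital real algebra generated by
the image of an injective linear map `f : ℝ^(p+q) → A` with `f v * f v = B v v • 1`,
`n = p + q` is odd, and the product `f e_1 ⋯ f e_n` over the standard basis equals
`λ • 1` for some real `λ`, then `λ = ±1`, `p - q ≡ 1 (mod 4)`, and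
`dim_ℝ A = 2 ^ (n - 1)`. -/
theorem stmt_14 (p q : ℕ) (A : Type*) [Ring A] [Algebra ℝ A] (hA : (1 : A) ≠ 0)
    (f : (Fin (p + q) → ℝ) →ₗ[ℝ] A) (hinj : Function.Injective ⇑f)
    (hsq : ∀ v : Fin (p + q) → ℝ, f v * f v = algebraMap ℝ A (Bpq p q v v))
    (hgen : Algebra.adjoin ℝ (Set.range ⇑f) = ⊤)
    (hodd : Odd (p + q))
    (lam : ℝ)
    (hprod : (List.ofFn fun i : Fin (p + q) => f (Pi.single i 1)).prod =
      algebraMap ℝ A lam) :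
    (lam = 1 ∨ lam = -1) ∧
    (4 : ℤ) ∣ ((p : ℤ) - (q : ℤ) - 1) ∧
    Module.finrank ℝ A = 2 ^ (p + q - 1) := by
  have hnt : Nontrivial A := ⟨1, 0, hA⟩
  let g : Fin (p + q) → A := fun i => f (Pi.single i 1)
  let ε : Fin (p + q) → ℝ := fun i => if i.val < p then 1 else -1
  have hε : ∀ i, ε i = 1 ∨ ε i = -1 := by
    intro i
    by_cases h : i.val < p <;> simp [ε, h]
  have hB : ∀ i j : Fin (p + q), Bpq p q (Pi.single i 1) (Pi.single j 1) =
      if i = j then ε i else 0 := by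
    intro i j
    simp only [Bpq, LinearMap.mk₂_apply]
    rw [Finset.sum_eq_single i]
    · by_cases h : i = j
      · subst h; simp [ε]
      · simp [h]
    · intro b _ hb; simp [hb]
    · simp
  have hg : ∀ i, g i * g i = algebraMap ℝ A (ε i) := by
    intro i
    simp only [g]
    rw [hsq, hB]; simp
  have hc : ∀ i j, i ≠ j → g i * g j = -(g j * g i) := by
    intro i j hij
    have h := hsq (Pi.single i 1 + Pi.single j 1)
    have h1 := hsq (Pi.single i 1)
    have h2 := hsq (Pi.single j 1)
    simp only [map_add, LinearMap.add_apply, hB, hij, hij.symm, if_true, if_false, add_zero,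
      zero_add, map_zero, add_mul, mul_add] at h h1 h2
    rw [h1, h2] at h
    simp only [g]
    rw [eq_neg_iff_add_eq_zero]
    have := sub_eq_zero.2 h
    rw [← this]
    abel
  have hl : lpr g (List.finRange (p + q)) = algebraMap ℝ A lam := by
    rw [← hprod, lpr, List.ofFn_eq_map]
  have hgen' : Algebra.adjoin ℝ (Set.range g) = ⊤ := by
    rw [eq_top_iff, ← hgen, Algebra.adjoin_le_iff]
    rintro _ ⟨v, rfl⟩
    have hv : f v = ∑ i, v i • g i := by
      rw [LinearMap.pi_apply_eq_sum_univ f v]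
      refine Finset.sum_congr rfl fun i _ => ?_
      congr 2
      funext j
      simp [Pi.single_apply, eq_comm]
    rw [hv]
    exact Subalgebra.sum_mem _ fun i _ =>
      Subalgebra.smul_mem _ (Algebra.subset_adjoin (Set.mem_range_self i)) _
  have hs := lpr_sq g ε hg hc _ (List.nodup_finRange (p + q))
  have hεp : ((List.finRange (p + q)).map ε).prod = (-1) ^ q := by
    rw [← List.ofFn_eq_map, List.prod_ofFn, Fin.prod_univ_add]
    simp [ε]
  rw [hl, ← map_mul, hεp, List.length_finRange, ← pow_add] at hs
  have hs' := FaithfulSMul.algebraMap_injective ℝ A hs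
  have hev : Even ((p + q) * (p + q - 1) / 2 + q) := by
    by_contra h
    rw [Nat.not_even_iff_odd] at h
    rw [h.neg_one_pow] at hs'
    nlinarith [mul_self_nonneg lam]
  refine ⟨?_, ?_, ?_⟩
  · rw [hev.neg_one_pow] at hs'
    exact mul_self_eq_one_iff.1 hs'
  · obtain ⟨m, hm⟩ := hodd
    rw [hm, Nat.add_sub_cancel, show (2 * m + 1) * (2 * m) = (m * (2 * m + 1)) * 2 by ring,
      Nat.mul_div_cancel _ two_pos] at hev
    obtain ⟨k, hk⟩ := hev
    have h1 : m * (2 * m + 1) = 2 * (m * m) + m := by ring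
    generalize m * m = z at *
    omega
  · have b := Module.Basis.mk (indep_even g ε hε hg hc hA)
      (span_even g ε hε hg hc hodd hgen' lam hl).ge
    rw [Module.finrank_eq_card_basis b, card_even hodd]
end

section
/- Let T be an orthogonal transformation of ℝ^{p,q}. Suppose there exist invertible vectors s_1, …, s_k with k ≤ p+q such that T = φ_{s_1} ∘ ⋯ ∘ φ_{s_k}, and suppose the Clifford product ι(s_1)·ι(s_2)⋯ι(s_k) has grade t (so t ≤ k). Then T cannot be factored into fewer than t hyperplane reflections: for any invertible vectors u_1, …, u_l with T = φ_{u_1} ∘ ⋯ ∘ φ_{u_l}, one has l ≥ t. -/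
/-- The reflection with respect to the hyperplane orthogonal to `s`:
`φ_s x = x - (2 * B x s / B s s) • s`. -/
noncomputable def reflpq (p q : ℕ) (s x : Fin (p + q) → ℝ) : Fin (p + q) → ℝ :=
  x - (2 * Bpq p q x s / Bpq p q s s) • s

/-- The degree-`t` component (in the `t`-th exterior power) of the image of a Clifford
algebra element under the linear equivalence with the exterior algebra
(`CliffordAlgebra.equivExterior`, available since `2` is invertible in `ℝ`). -/
noncomputable def gradeComponent (p q : ℕ) (a : CliffordAlgebra (Qpq p q)) (t : ℕ) :
    ⋀[ℝ]^t (Fin (p + q) → ℝ) :=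
  DirectSum.decompose (fun i : ℕ => ⋀[ℝ]^i (Fin (p + q) → ℝ))
    (CliffordAlgebra.equivExterior (Qpq p q) a) t

/-- `a` has grade `t`: its degree-`t` component is nonzero and all higher components
vanish. -/
def HasGrade (p q : ℕ) (a : CliffordAlgebra (Qpq p q)) (t : ℕ) : Prop :=
  gradeComponent p q a t ≠ 0 ∧ ∀ u : ℕ, t < u → gradeComponent p q a u = 0

open CliffordAlgebra in
theorem aux_reflect_mul (p q : ℕ) (s x : Fin (p + q) → ℝ) (hs : Bpq p q s s ≠ 0) :
    ι (Qpq p q) (reflpq p q s x) * ι (Qpq p q) s = -(ι (Qpq p q) s * ι (Qpq p q) x) := by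
  have hsymm : ∀ x y, Bpq p q x y = Bpq p q y x := by
    intro x y
    simp [Bpq, mul_comm]
  have h2 := ι_mul_ι_add_swap (Q := Qpq p q) x s
  have hp : QuadraticMap.polar (Qpq p q) x s = 2 * Bpq p q x s := by
    simp [QuadraticMap.polar, Qpq, hsymm s x]; ring
  rw [hp] at h2
  have h3 : ι (Qpq p q) s * ι (Qpq p q) s = algebraMap ℝ _ (Bpq p q s s) := by
    rw [ι_sq_scalar]; rfl
  rw [reflpq, map_sub, map_smul, sub_mul, smul_mul_assoc, h3, Algebra.smul_def, ← map_mul (algebraMap ℝ (CliffordAlgebra (Qpq p q))), div_mul_cancel₀ _ hs, ← h2]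
  abel

open CliffordAlgebra in
theorem aux_prod (p q : ℕ) : ∀ (k : ℕ) (s : Fin k → (Fin (p + q) → ℝ))
    (_ : ∀ i, Bpq p q (s i) (s i) ≠ 0) (x : Fin (p + q) → ℝ),
    ι (Qpq p q) ((List.ofFn fun i => reflpq p q (s i)).foldr (· ∘ ·) id x) *
      (List.ofFn fun i => ι (Qpq p q) (s i)).prod =
    involute ((List.ofFn fun i => ι (Qpq p q) (s i)).prod) * ι (Qpq p q) x := by
  intro k
  induction k with
  | zero => intro s hs x; simp
  | succ k ih =>
    intro s hs x
    simp only [List.ofFn_succ, List.foldr_cons, List.prod_cons, Function.comp_apply, map_mul,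
      involute_ι]
    rw [← mul_assoc, aux_reflect_mul p q _ _ (hs 0), neg_mul, mul_assoc,
      ih (fun i => s i.succ) (fun i => hs i.succ) x, neg_mul, neg_mul, mul_assoc]

open CliffordAlgebra in
theorem aux_inv (p q : ℕ) : ∀ (k : ℕ) (s : Fin k → (Fin (p + q) → ℝ))
    (_ : ∀ i, Bpq p q (s i) (s i) ≠ 0),
    IsUnit (List.ofFn fun i => ι (Qpq p q) (s i)).prod := by
  intro k s hs
  refine Submonoid.list_prod_mem (IsUnit.submonoid (CliffordAlgebra (Qpq p q))) ?_
  intro x hx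
  obtain ⟨i, rfl⟩ := (List.mem_ofFn' _ _).1 hx
  exact (isUnit_iff_ne_zero.2 (hs i)).map (algebraMap ℝ (CliffordAlgebra (Qpq p q))) |> fun h => by
    have h3 : ι (Qpq p q) (s i) * ι (Qpq p q) (s i) =
        algebraMap ℝ _ (Bpq p q (s i) (s i)) := by
      rw [ι_sq_scalar]; rfl
    rw [← h3] at h
    exact (Commute.isUnit_mul_iff (Commute.refl _)).1 h |>.1

open CliffordAlgebra in
theorem aux_contract (p q : ℕ) (v : Fin (p + q) → ℝ) (W : CliffordAlgebra (Qpq p q)) :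
    ι (Qpq p q) v * W - involute W * ι (Qpq p q) v =
      (2 : ℝ) • contractLeft (Bpq p q v) W := by
  have hsymm : ∀ x y, Bpq p q x y = Bpq p q y x := by
    intro x y
    simp [Bpq, mul_comm]
  induction W using CliffordAlgebra.left_induction with
  | algebraMap r => simp [Algebra.commutes]
  | add x y hx hy =>
    rw [map_add, map_add, smul_add, ← hx, ← hy]; noncomm_ring
  | ι_mul y a hy =>
    have h2 := ι_mul_ι_add_swap (Q := Qpq p q) v a
    have hp : QuadraticMap.polar (Qpq p q) v a = 2 * Bpq p q v a := by
      simp [QuadraticMap.polar, Qpq, hsymm a v]; ring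
    rw [hp] at h2
    rw [contractLeft_ι_mul, smul_sub, ← mul_smul_comm, ← hy, smul_smul, Algebra.smul_def, ← h2,
      map_mul, involute_ι]
    noncomm_ring

open CliffordAlgebra in
/-- The number operator on the exterior algebra. -/
noncomputable def auxE (n : ℕ) :
    ExteriorAlgebra ℝ (Fin n → ℝ) →ₗ[ℝ] ExteriorAlgebra ℝ (Fin n → ℝ) :=
  ∑ i : Fin n, (LinearMap.mulLeft ℝ (ExteriorAlgebra.ι ℝ (Pi.single i (1 : ℝ)))) ∘ₗ
    (contractLeft (Q := (0 : QuadraticForm ℝ (Fin n → ℝ))) (LinearMap.proj i))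

open CliffordAlgebra in
theorem auxE_ι_mul (n : ℕ) (a : Fin n → ℝ) (y : ExteriorAlgebra ℝ (Fin n → ℝ)) :
    auxE n (ExteriorAlgebra.ι ℝ a * y) =
      ExteriorAlgebra.ι ℝ a * y + ExteriorAlgebra.ι ℝ a * auxE n y := by
  have hc : ∀ i : Fin n, contractLeft (Q := (0 : QuadraticForm ℝ (Fin n → ℝ)))
      (LinearMap.proj i) (ExteriorAlgebra.ι ℝ a * y) =
      a i • y - ExteriorAlgebra.ι ℝ a * contractLeft (Q := (0 : QuadraticForm ℝ (Fin n → ℝ)))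
      (LinearMap.proj i) y := fun i => contractLeft_ι_mul _ a y
  have ha : ExteriorAlgebra.ι ℝ a =
      ∑ i : Fin n, a i • ExteriorAlgebra.ι ℝ (Pi.single i (1 : ℝ)) := by
    conv_lhs => rw [pi_eq_sum_univ' a]
    simp only [map_sum, map_smul]
  have hsw : ∀ i : Fin n, ExteriorAlgebra.ι ℝ (Pi.single i (1 : ℝ)) * ExteriorAlgebra.ι ℝ a =
      - (ExteriorAlgebra.ι ℝ a * ExteriorAlgebra.ι ℝ (Pi.single i (1 : ℝ))) := fun i =>
    eq_neg_of_add_eq_zero_left (ExteriorAlgebra.ι_add_mul_swap _ _)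
  simp only [auxE, LinearMap.sum_apply, LinearMap.comp_apply, LinearMap.mulLeft_apply, hc,
    mul_sub, mul_smul_comm, ← mul_assoc, hsw, Finset.sum_sub_distrib]
  rw [Finset.mul_sum]
  have hay : ExteriorAlgebra.ι ℝ a * y =
      ∑ i : Fin n, a i • (ExteriorAlgebra.ι ℝ (Pi.single i (1 : ℝ)) * y) := by
    conv_lhs => rw [ha]
    simp [Finset.sum_mul]
  rw [hay]
  simp [mul_assoc]

theorem auxE_of_mem (n m : ℕ) (x : ExteriorAlgebra ℝ (Fin n → ℝ))
    (hx : x ∈ ⋀[ℝ]^m (Fin n → ℝ)) : auxE n x = (m : ℝ) • x := by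
  induction hx using Submodule.pow_induction_on_left' with
  | algebraMap r => simp [auxE, CliffordAlgebra.contractLeft_algebraMap]
  | add x y i hx hy ihx ihy => rw [map_add, ihx, ihy, smul_add]
  | mem_mul m hm i x hx ih =>
    obtain ⟨a, rfl⟩ := hm
    rw [auxE_ι_mul, ih]
    push_cast
    rw [add_smul, one_smul, mul_smul_comm, add_comm]

open CliffordAlgebra in
theorem aux_scalar_ext (n : ℕ) (x : ExteriorAlgebra ℝ (Fin n → ℝ))
    (hx : auxE n x = 0) : ∃ c : ℝ, x = algebraMap ℝ _ c := by
  classical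
  have key : ∀ (y : ExteriorAlgebra ℝ (Fin n → ℝ)) (m : ℕ),
      (DirectSum.decompose (fun i : ℕ => ⋀[ℝ]^i (Fin n → ℝ)) (auxE n y) m : ExteriorAlgebra ℝ (Fin n → ℝ)) =
      (m : ℝ) • (DirectSum.decompose (fun i : ℕ => ⋀[ℝ]^i (Fin n → ℝ)) y m : ExteriorAlgebra ℝ (Fin n → ℝ)) := by
    intro y m
    induction y using DirectSum.Decomposition.inductionOn (fun i : ℕ => ⋀[ℝ]^i (Fin n → ℝ)) with
    | zero => simp
    | @homogeneous j z =>
      rw [auxE_of_mem n _ z z.2, DirectSum.decompose_smul, DirectSum.smul_apply]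
      by_cases h : j = m
      · subst h; simp
      · have hz := DirectSum.decompose_of_mem_ne (fun i : ℕ => ⋀[ℝ]^i (Fin n → ℝ)) z.2 h
        rw [Submodule.coe_smul, hz, smul_zero, smul_zero]
    | add y z hy hz =>
      simp only [map_add, DirectSum.decompose_add, DirectSum.add_apply, Submodule.coe_add, hy, hz,
        smul_add]
  have h0 : ∀ m : ℕ, m ≠ 0 →
      (DirectSum.decompose (fun i : ℕ => ⋀[ℝ]^i (Fin n → ℝ)) x m : ExteriorAlgebra ℝ (Fin n → ℝ)) = 0 := by
    intro m hm
    have := key x m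
    rw [hx] at this
    simpa [hm] using this.symm
  have hx0 : x = (DirectSum.decompose (fun i : ℕ => ⋀[ℝ]^i (Fin n → ℝ)) x 0 : ExteriorAlgebra ℝ (Fin n → ℝ)) := by
    conv_lhs => rw [← DirectSum.sum_support_decompose (fun i : ℕ => ⋀[ℝ]^i (Fin n → ℝ)) x]
    apply Finset.sum_eq_single
    · intro b _ hb; exact h0 b hb
    · intro h; simpa using h
  have hm := (DirectSum.decompose (fun i : ℕ => ⋀[ℝ]^i (Fin n → ℝ)) x 0).2
  rw [← hx0] at hm
  change x ∈ _ ^ 0 at hm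
  rw [pow_zero, Submodule.mem_one] at hm
  obtain ⟨c, hc⟩ := hm
  exact ⟨c, hc.symm⟩

open CliffordAlgebra in
theorem aux_scalar (p q : ℕ) (W : CliffordAlgebra (Qpq p q))
    (h : ∀ v, ι (Qpq p q) v * W = involute W * ι (Qpq p q) v) :
    ∃ c : ℝ, W = algebraMap ℝ _ c := by
  have h1 : ∀ v, contractLeft (Bpq p q v) W = 0 := by
    intro v
    have := aux_contract p q v W
    rw [h v, sub_self] at this
    simpa using this.symm
  have h2 : ∀ i : Fin (p + q), contractLeft (Q := Qpq p q) (LinearMap.proj i) W = 0 := by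
    intro i
    have hB : (LinearMap.proj i : (Fin (p + q) → ℝ) →ₗ[ℝ] ℝ) =
        Bpq p q (Pi.single i (if i.val < p then (1 : ℝ) else -1)) := by
      ext j
      simp only [Bpq, LinearMap.coe_comp, Function.comp_apply, LinearMap.mk₂_apply,
        LinearMap.coe_single, LinearMap.proj_apply]
      rw [Finset.sum_eq_single i]
      · by_cases hj : i.val < p <;> simp [hj]
      · intro b _ hb; simp [hb]
      · intro h; exact absurd (Finset.mem_univ i) h
    rw [hB, h1]
  have h3 : auxE (p + q) (equivExterior (Qpq p q) W) = 0 := by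
    simp only [auxE, LinearMap.sum_apply, LinearMap.comp_apply]
    refine Finset.sum_eq_zero fun i _ => ?_
    have := changeForm_contractLeft (changeForm.associated_neg_proof (Q := Qpq p q)) (LinearMap.proj i) W
    rw [h2 i, map_zero] at this
    erw [← this]
    simp
  obtain ⟨c, hc⟩ := aux_scalar_ext _ _ h3
  refine ⟨c, (equivExterior (Qpq p q)).injective ?_⟩
  rw [hc]
  exact (changeForm_algebraMap (changeForm.associated_neg_proof (Q := Qpq p q)) c).symm

/-- Filtration generator. -/
noncomputable def auxN (n : ℕ) : Submodule ℝ (ExteriorAlgebra ℝ (Fin n → ℝ)) :=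
  1 ⊔ LinearMap.range (ExteriorAlgebra.ι ℝ : (Fin n → ℝ) →ₗ[ℝ] _)

theorem aux_ι_mem (n : ℕ) (a : Fin n → ℝ) : ExteriorAlgebra.ι ℝ a ∈ auxN n :=
  Submodule.mem_sup_right ⟨a, rfl⟩

theorem auxN_mono (n l : ℕ) : auxN n ^ l ≤ auxN n ^ (l + 1) :=
  pow_le_pow_right₀ (le_sup_left : (1 : Submodule ℝ (ExteriorAlgebra ℝ (Fin n → ℝ))) ≤ auxN n) (Nat.le_succ l)

open CliffordAlgebra in
theorem aux_contract_mem (n l : ℕ) (d : Module.Dual ℝ (Fin n → ℝ))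
    (x : ExteriorAlgebra ℝ (Fin n → ℝ)) (hx : x ∈ auxN n ^ l) :
    contractLeft (Q := (0 : QuadraticForm ℝ (Fin n → ℝ))) d x ∈ auxN n ^ l := by
  induction hx using Submodule.pow_induction_on_left' with
  | algebraMap r =>
    have : contractLeft (Q := (0 : QuadraticForm ℝ (Fin n → ℝ))) d (algebraMap ℝ _ r) = 0 :=
      contractLeft_algebraMap _ _ _
    erw [this]; exact zero_mem _
  | add x y i hx hy ihx ihy => erw [map_add]; exact add_mem ihx ihy
  | mem_mul m hm i x hx ih =>
    obtain ⟨y, hy, z, hz, rfl⟩ := Submodule.mem_sup.1 hm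
    obtain ⟨r, rfl⟩ := Submodule.mem_one.1 hy
    obtain ⟨a, rfl⟩ := hz
    rw [add_mul]
    have e1 : contractLeft (Q := (0 : QuadraticForm ℝ (Fin n → ℝ))) d
      (algebraMap ℝ _ r * x) = algebraMap ℝ _ r * contractLeft (Q := (0 : QuadraticForm ℝ (Fin n → ℝ))) d x :=
      contractLeft_algebraMap_mul _ _ _
    have e2 : contractLeft (Q := (0 : QuadraticForm ℝ (Fin n → ℝ))) d
      (ExteriorAlgebra.ι ℝ a * x) = d a • x - ExteriorAlgebra.ι ℝ a * contractLeft (Q := (0 : QuadraticForm ℝ (Fin n → ℝ))) d x :=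
      contractLeft_ι_mul _ _ _
    erw [map_add, e1, e2]
    refine add_mem ?_ (sub_mem ?_ ?_)
    · erw [← Algebra.smul_def]
      exact Submodule.smul_mem _ _ (auxN_mono n i ih)
    · exact Submodule.smul_mem _ _ (auxN_mono n i hx)
    · rw [pow_succ']
      exact Submodule.mul_mem_mul (aux_ι_mem n a) ih

theorem aux_comp_zero (n l : ℕ) (x : ExteriorAlgebra ℝ (Fin n → ℝ)) (hx : x ∈ auxN n ^ l) :
    ∀ u, l < u → (DirectSum.decompose (fun i : ℕ => ⋀[ℝ]^i (Fin n → ℝ)) x u : ExteriorAlgebra ℝ (Fin n → ℝ)) = 0 := by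
  induction hx using Submodule.pow_induction_on_left' with
  | algebraMap r =>
    intro u hu
    have h0 : algebraMap ℝ (ExteriorAlgebra ℝ (Fin n → ℝ)) r ∈ ⋀[ℝ]^0 (Fin n → ℝ) := by
      change _ ∈ _ ^ 0
      rw [pow_zero]; exact Submodule.mem_one.2 ⟨r, rfl⟩
    exact DirectSum.decompose_of_mem_ne (fun i : ℕ => ⋀[ℝ]^i (Fin n → ℝ)) h0 hu.ne
  | add x y i hx hy ihx ihy =>
    intro u hu
    rw [DirectSum.decompose_add, DirectSum.add_apply, Submodule.coe_add, ihx u hu, ihy u hu, add_zero]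
  | mem_mul m hm i x hx ih =>
    intro u hu
    obtain ⟨y, hy, z, hz, rfl⟩ := Submodule.mem_sup.1 hm
    obtain ⟨r, rfl⟩ := Submodule.mem_one.1 hy
    obtain ⟨a, rfl⟩ := hz
    have h1 : ExteriorAlgebra.ι ℝ a ∈ ⋀[ℝ]^1 (Fin n → ℝ) := by
      change _ ∈ _ ^ 1
      rw [pow_one]; exact ⟨a, rfl⟩
    rw [add_mul, DirectSum.decompose_add, DirectSum.add_apply, Submodule.coe_add,
      ← Algebra.smul_def, DirectSum.decompose_smul, DirectSum.smul_apply, Submodule.coe_smul,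
      ih u (by omega), smul_zero, zero_add,
      DirectSum.coe_decompose_mul_of_left_mem_of_le (fun i : ℕ => ⋀[ℝ]^i (Fin n → ℝ)) h1 (by omega),
      ih (u - 1) (by omega), mul_zero]

open CliffordAlgebra in
theorem aux_prod_mem (p q : ℕ) : ∀ (k : ℕ) (s : Fin k → (Fin (p + q) → ℝ)),
    equivExterior (Qpq p q) (List.ofFn fun i => ι (Qpq p q) (s i)).prod ∈ auxN (p + q) ^ k := by
  intro k
  induction k with
  | zero =>
    intro s
    have : equivExterior (Qpq p q) 1 = 1 := changeForm_one (changeForm.associated_neg_proof (Q := Qpq p q))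
    simp only [List.ofFn_zero, List.prod_nil, this, pow_zero]
    exact Submodule.mem_one.2 ⟨1, map_one _⟩
  | succ k ih =>
    intro s
    simp only [List.ofFn_succ, List.prod_cons]
    have h := changeForm_ι_mul (changeForm.associated_neg_proof (Q := Qpq p q)) (s 0)
      (List.ofFn fun i : Fin k => ι (Qpq p q) (s i.succ)).prod
    have hih := ih (fun i => s i.succ)
    change changeForm (changeForm.associated_neg_proof (Q := Qpq p q)) _ ∈ _
    rw [h]
    refine sub_mem ?_ ?_
    · rw [pow_succ']
      exact Submodule.mul_mem_mul (aux_ι_mem _ _) hih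
    · exact auxN_mono _ _ (aux_contract_mem _ _ _ _ hih)

/-- if `T = φ_{s_1} ∘ ⋯ ∘ φ_{s_k}` with `k ≤ p + q` and the Clifford
product `ι s_1 ⋯ ι s_k` has grade `t`, then `T` cannot be factored into fewer than
`t` hyperplane reflections. -/
theorem stmt_17 (p q k t : ℕ) (T : (Fin (p + q) → ℝ) →ₗ[ℝ] (Fin (p + q) → ℝ))
    (horth : ∀ x y : Fin (p + q) → ℝ, Bpq p q (T x) (T y) = Bpq p q x y)
    (s : Fin k → (Fin (p + q) → ℝ)) (hk : k ≤ p + q)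
    (hs : ∀ i, Bpq p q (s i) (s i) ≠ 0)
    (hT : ⇑T = (List.ofFn fun i => reflpq p q (s i)).foldr (· ∘ ·) id)
    (hgr : HasGrade p q ((List.ofFn fun i => CliffordAlgebra.ι (Qpq p q) (s i)).prod) t) :
    ∀ (l : ℕ) (u : Fin l → (Fin (p + q) → ℝ)),
      (∀ i, Bpq p q (u i) (u i) ≠ 0) →
      ⇑T = (List.ofFn fun i => reflpq p q (u i)).foldr (· ∘ ·) id →
      t ≤ l := by
  intro l u hu hTu
  set S := (List.ofFn fun i => CliffordAlgebra.ι (Qpq p q) (s i)).prod with hS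
  set U := (List.ofFn fun i => CliffordAlgebra.ι (Qpq p q) (u i)).prod with hU
  have hSx : ∀ x, CliffordAlgebra.ι (Qpq p q) (T x) * S =
      CliffordAlgebra.involute S * CliffordAlgebra.ι (Qpq p q) x := by
    intro x; rw [hT]; exact aux_prod p q k s hs x
  have hUx : ∀ x, CliffordAlgebra.ι (Qpq p q) (T x) * U =
      CliffordAlgebra.involute U * CliffordAlgebra.ι (Qpq p q) x := by
    intro x; rw [hTu]; exact aux_prod p q l u hu x
  obtain ⟨V, hV⟩ := (aux_inv p q l u hu).exists_left_inv
  have hVr : U * V = 1 := by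
    obtain ⟨Vr, hVr⟩ := (aux_inv p q l u hu).exists_right_inv
    rwa [left_inv_eq_right_inv hV hVr]
  have hW : ∀ v, CliffordAlgebra.ι (Qpq p q) v * (V * S) =
      CliffordAlgebra.involute (V * S) * CliffordAlgebra.ι (Qpq p q) v := by
    intro v
    have hVU : CliffordAlgebra.involute V * CliffordAlgebra.involute U = 1 := by
      rw [← map_mul, hV, map_one]
    rw [map_mul, mul_assoc, ← hSx v]
    calc CliffordAlgebra.ι (Qpq p q) v * (V * S)
        = CliffordAlgebra.involute V * (CliffordAlgebra.involute U *
            CliffordAlgebra.ι (Qpq p q) v) * (V * S) := by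
          rw [← mul_assoc (CliffordAlgebra.involute V), hVU, one_mul]
      _ = CliffordAlgebra.involute V * (CliffordAlgebra.ι (Qpq p q) (T v) * ((U * V) * S)) := by
          rw [← hUx v]; simp only [mul_assoc]
      _ = _ := by rw [hVr, one_mul]
  obtain ⟨c, hc⟩ := aux_scalar p q _ hW
  have hSU : S = c • U := by
    calc S = U * (V * S) := by rw [← mul_assoc, hVr, one_mul]
      _ = c • U := by rw [hc, ← Algebra.commutes, Algebra.smul_def]
  by_contra hlt
  apply hgr.1
  apply Subtype.ext
  change (DirectSum.decompose (fun i : ℕ => ⋀[ℝ]^i (Fin (p + q) → ℝ))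
    (CliffordAlgebra.equivExterior (Qpq p q) S) t : ExteriorAlgebra ℝ (Fin (p + q) → ℝ)) = 0
  apply aux_comp_zero (p + q) l _ _ t (by omega)
  rw [hSU, map_smul]
  exact Submodule.smul_mem _ _ (aux_prod_mem p q l u)
end

section
/- Let T be an orthogonal transformation of ℝ^{p,q}. Suppose there exist invertible vectors s_1, …, s_k such that T = φ_{s_1} ∘ ⋯ ∘ φ_{s_k}, that the Clifford product ι(s_1)·ι(s_2)⋯ι(s_k) has grade t, and that the restriction of B to Ker(T − I) is nondegenerate. Then T can be factored into exactly t hyperplane reflections (there exist invertible vectors u_1, …, u_t with T = φ_{u_1} ∘ ⋯ ∘ φ_{u_t}), and moreover dim (Ker(T − I))^⊥ = t. -/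
section helpers
variable {p q : ℕ}

lemma Bpq_apply' (x y : Fin (p + q) → ℝ) : Bpq p q x y =
    ∑ i : Fin (p + q), (if i.val < p then (1 : ℝ) else -1) * (x i * y i) := rfl

lemma Bpq_symm (x y : Fin (p + q) → ℝ) : Bpq p q x y = Bpq p q y x := by
  simp only [Bpq_apply', mul_comm (x _)]

lemma Bpq_sep (x : Fin (p + q) → ℝ) (h : ∀ y, Bpq p q x y = 0) : x = 0 := by
  funext i
  have := h (Pi.single i 1)
  rw [Bpq_apply', Finset.sum_eq_single i] at this
  · simp at this
    split_ifs at this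
    · simpa using this
    · simpa using this
  · intro b _ hb
    simp [hb]
  · simp

lemma Bpq_isSymm : (Bpq p q).IsSymm := ⟨fun x y => Bpq_symm x y⟩

lemma Bpq_nondeg_s18 : (Bpq p q).Nondegenerate :=
  ⟨fun x h => Bpq_sep x h, fun x h => Bpq_sep x (fun y => by rw [Bpq_symm]; exact h y)⟩

/-- reflection as a linear map -/
noncomputable def reflL (p q : ℕ) (s : Fin (p + q) → ℝ) :
    (Fin (p + q) → ℝ) →ₗ[ℝ] (Fin (p + q) → ℝ) :=
  LinearMap.id - (2 / Bpq p q s s) • ((Bpq p q).flip s).smulRight s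

lemma reflL_apply (s x : Fin (p + q) → ℝ) : reflL p q s x = reflpq p q s x := by
  simp [reflL, reflpq, smul_smul]
  congr 1
  ring

lemma reflpq_invol (s : Fin (p + q) → ℝ) (hs : Bpq p q s s ≠ 0) (x : Fin (p + q) → ℝ) :
    reflpq p q s (reflpq p q s x) = x := by
  simp only [reflpq, map_sub, map_smul, LinearMap.sub_apply, LinearMap.smul_apply, smul_eq_mul]
  rw [sub_sub, ← add_smul]
  have : 2 * Bpq p q x s / Bpq p q s s +
    2 * (Bpq p q x s - 2 * Bpq p q x s / Bpq p q s s * Bpq p q s s) / Bpq p q s s = 0 := by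
    field_simp; ring
  rw [this]; simp

lemma reflpq_orth (s : Fin (p + q) → ℝ) (hs : Bpq p q s s ≠ 0) (x y : Fin (p + q) → ℝ) :
    Bpq p q (reflpq p q s x) (reflpq p q s y) = Bpq p q x y := by
  simp only [reflpq, map_sub, map_smul, LinearMap.sub_apply, LinearMap.smul_apply, smul_eq_mul]
  rw [Bpq_symm s y]
  field_simp; ring

/-- choice of a good vector -/
lemma exists_good (T : (Fin (p + q) → ℝ) →ₗ[ℝ] (Fin (p + q) → ℝ))
    (horth : ∀ x y : Fin (p + q) → ℝ, Bpq p q (T x) (T y) = Bpq p q x y)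
    (hker : ∀ x ∈ LinearMap.ker (T - LinearMap.id),
      (∀ y ∈ LinearMap.ker (T - LinearMap.id), Bpq p q x y = 0) → x = 0)
    (hne : LinearMap.ker (T - LinearMap.id) ≠ ⊤) :
    ∃ x, (∀ y ∈ LinearMap.ker (T - LinearMap.id), Bpq p q x y = 0) ∧ Bpq p q x x ≠ 0 ∧
      Bpq p q (T x - x) (T x - x) ≠ 0 := by
  set F := LinearMap.ker (T - LinearMap.id) with hF
  have memF : ∀ y, y ∈ F ↔ T y = y := by
    intro y; rw [hF, LinearMap.mem_ker]; simp [sub_eq_zero]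
  set W := (Bpq p q).orthogonal F with hW
  have memW : ∀ y, y ∈ W ↔ ∀ f ∈ F, Bpq p q y f = 0 := by
    intro y
    rw [hW, LinearMap.BilinForm.mem_orthogonal_iff]
    refine forall₂_congr fun f _ => ?_
    rw [Bpq_symm]
  have hdisj : F ⊓ W = ⊥ := by
    rw [eq_bot_iff]
    rintro x ⟨h1, h2⟩
    exact hker x h1 ((memW x).1 h2)
  have hcompl : F ⊔ W = ⊤ := by
    apply Submodule.eq_top_of_disjoint _ _ _ (disjoint_iff.2 hdisj)
    rw [hW, LinearMap.BilinForm.finrank_orthogonal Bpq_nondeg_s18]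
    have := Submodule.finrank_le F
    omega
  -- an anisotropic vector in W
  have ha : ∃ a ∈ W, Bpq p q a a ≠ 0 := by
    by_contra! hcon
    apply hne
    have hWbot : W = ⊥ := by
      rw [eq_bot_iff]
      intro w hw
      refine Bpq_sep w fun v => ?_
      have hv : v ∈ F ⊔ W := by rw [hcompl]; trivial
      obtain ⟨f, hf, w', hw', rfl⟩ := Submodule.mem_sup.1 hv
      rw [map_add, (memW w).1 hw f hf, zero_add]
      have h1 := hcon (w + w') (W.add_mem hw hw')
      simp only [map_add, LinearMap.add_apply, hcon w hw, hcon w' hw', Bpq_symm w' w] at h1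
      linarith
    rw [← hcompl, hWbot, sup_bot_eq]
  obtain ⟨a, haW, haa⟩ := ha
  have hmap : ∀ x ∈ W, (T - LinearMap.id : (Fin (p + q) → ℝ) →ₗ[ℝ] (Fin (p + q) → ℝ)) x ∈ W := by
    intro x _
    rw [memW]
    intro f hf
    have := horth x f
    rw [(memF f).1 hf] at this
    simp [this]
  have hinj : Function.Injective ((T - LinearMap.id).restrict hmap) := by
    rw [← LinearMap.ker_eq_bot, eq_bot_iff]
    rintro ⟨x, hx⟩ h
    have h' : (T - LinearMap.id : (Fin (p + q) → ℝ) →ₗ[ℝ] (Fin (p + q) → ℝ)) x = 0 := congrArg Subtype.val h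
    have : x ∈ F ⊓ W := ⟨h', hx⟩
    rw [hdisj] at this
    simpa using this
  obtain ⟨⟨b, hbW⟩, hb⟩ := (LinearMap.injective_iff_surjective.1 hinj) ⟨a, haW⟩
  have hb' : T b - b = a := congrArg Subtype.val hb
  have key : ∃ x ∈ W, Bpq p q x x ≠ 0 ∧ Bpq p q (T x - x) (T x - x) ≠ 0 := by
    by_cases h1 : Bpq p q b b = 0
    swap
    · exact ⟨b, hbW, h1, by rw [hb']; exact haa⟩
    by_cases h2 : Bpq p q (T a - a) (T a - a) = 0
    swap
    · exact ⟨a, haW, haa, h2⟩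
    by_contra! hcon
    have hh : ∀ t : ℝ, Bpq p q a a + 2 * t * Bpq p q a b ≠ 0 →
        2 * t * Bpq p q (T a - a) a + t ^ 2 * Bpq p q a a = 0 := by
      intro t ht
      have := hcon (a + t • b) (W.add_mem haW (W.smul_mem t hbW))
      have e1 : T (a + t • b) - (a + t • b) = (T a - a) + t • a := by
        rw [← hb']; simp only [map_add, map_smul]; module
      rw [e1] at this
      have e2 : Bpq p q (a + t • b) (a + t • b) = Bpq p q a a + 2 * t * Bpq p q a b := by
        simp only [map_add, map_smul, LinearMap.add_apply, LinearMap.smul_apply, smul_eq_mul, h1,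
          Bpq_symm b a]
        ring
      have e3 : Bpq p q ((T a - a) + t • a) ((T a - a) + t • a) =
          2 * t * Bpq p q (T a - a) a + t ^ 2 * Bpq p q a a := by
        rw [map_add, map_add, LinearMap.add_apply, LinearMap.add_apply, h2]
        simp only [map_smul, LinearMap.smul_apply, smul_eq_mul, Bpq_symm a (T a - a)]
        ring
      rw [← e3]
      exact this (by rw [e2]; exact ht)
    generalize Bpq p q a a = A at *
    generalize Bpq p q a b = C at *
    generalize Bpq p q (T a - a) a = D at *
    have g1 := hh 1
    have g2 := hh 2
    have g3 := hh 3
    by_cases k1 : A + 2 * 1 * C = 0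
    · have := g2 (fun h => haa (by linarith))
      have := g3 (fun h => haa (by linarith))
      exact haa (by linarith)
    · have := g1 k1
      by_cases k2 : A + 2 * 2 * C = 0
      · have := g3 (fun h => haa (by linarith))
        exact haa (by linarith)
      · have := g2 k2
        exact haa (by linarith)
  obtain ⟨x, hx, h⟩ := key
  exact ⟨x, (memW x).1 hx, h⟩

lemma exists_factor (r : ℕ) : ∀ (T : (Fin (p + q) → ℝ) →ₗ[ℝ] (Fin (p + q) → ℝ))
    (_ : ∀ x y : Fin (p + q) → ℝ, Bpq p q (T x) (T y) = Bpq p q x y)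
    (_ : ∀ x ∈ LinearMap.ker (T - LinearMap.id),
      (∀ y ∈ LinearMap.ker (T - LinearMap.id), Bpq p q x y = 0) → x = 0)
    (_ : Module.finrank ℝ (LinearMap.ker (T - LinearMap.id)) + r = p + q),
    ∃ l : List (Fin (p + q) → ℝ), l.length = r ∧ (∀ u ∈ l, Bpq p q u u ≠ 0) ∧
      ⇑T = (l.map (reflpq p q)).foldr (· ∘ ·) id := by
  induction r with
  | zero =>
    intro T horth hker hdim
    refine ⟨[], rfl, by simp, ?_⟩
    have : LinearMap.ker (T - LinearMap.id) = ⊤ := by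
      apply Submodule.eq_top_of_finrank_eq
      simpa using hdim
    rw [LinearMap.ker_eq_top, sub_eq_zero] at this
    simp [this]
  | succ r ih =>
    intro T horth hker hdim
    obtain ⟨x, hxF, hxx, huu⟩ := exists_good T horth hker (by
      intro h
      rw [h] at hdim
      simp at hdim)
    set F := LinearMap.ker (T - LinearMap.id) with hF
    have memF : ∀ y, y ∈ F ↔ T y = y := by
      intro y; rw [hF, LinearMap.mem_ker]; simp [sub_eq_zero]
    set u := T x - x with hu
    have huF : ∀ f ∈ F, Bpq p q f u = 0 := by
      intro f hf
      have := horth f x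
      rw [(memF f).1 hf] at this
      rw [hu, map_sub, this, sub_self]
    have hTu : 2 * Bpq p q (T x) u = Bpq p q u u := by
      simp only [hu, map_sub, LinearMap.sub_apply, horth x x, Bpq_symm x (T x)]
      ring
    have hxu : 2 * Bpq p q x u = - Bpq p q u u := by
      simp only [hu, map_sub, LinearMap.sub_apply, horth x x, Bpq_symm x (T x)]
      ring
    have hxu0 : Bpq p q x u ≠ 0 := by
      intro h; rw [h] at hxu; apply huu; linarith
    set T' := (reflL p q u).comp T with hT'
    have T'app : ∀ y, T' y = reflpq p q u (T y) := fun y => reflL_apply _ _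
    set F' := LinearMap.ker (T' - LinearMap.id) with hF'
    have memF' : ∀ y, y ∈ F' ↔ T' y = y := by
      intro y; rw [hF', LinearMap.mem_ker]; simp [sub_eq_zero]
    have hT'x : T' x = x := by
      rw [T'app, reflpq, hTu, div_self huu, hu]; simp
    have hFF' : F ≤ F' := by
      intro f hf
      rw [memF', T'app, (memF f).1 hf, reflpq, huF f hf]; simp
    have hF'eq : F' = F ⊔ Submodule.span ℝ {x} := by
      apply le_antisymm
      · intro y hy
        set c := Bpq p q y u / Bpq p q x u with hc
        have hz : y - c • x ∈ F := by
          have h1 : T' (y - c • x) = y - c • x := by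
            rw [map_sub, map_smul, hT'x, (memF' y).1 hy]
          have h2 : Bpq p q (y - c • x) u = 0 := by
            simp only [map_sub, map_smul, LinearMap.sub_apply, LinearMap.smul_apply, smul_eq_mul,
              hc]
            field_simp; ring
          rw [memF]
          have h3 := congrArg (reflpq p q u) h1
          rw [T'app, reflpq_invol u huu] at h3
          rw [h3, reflpq, h2]; simp
        rw [Submodule.mem_sup]
        exact ⟨_, hz, c • x, Submodule.smul_mem _ _ (Submodule.mem_span_singleton_self x), by simp⟩
      · apply sup_le hFF'
        rw [Submodule.span_singleton_le_iff_mem, memF']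
        exact hT'x
    have hdim' : Module.finrank ℝ F' = Module.finrank ℝ F + 1 := by
      have := Submodule.finrank_sup_add_finrank_inf_eq F (Submodule.span ℝ {x})
      have hinf : F ⊓ Submodule.span ℝ {x} = ⊥ := by
        rw [eq_bot_iff]
        rintro z ⟨hz1, hz2⟩
        obtain ⟨c, rfl⟩ := Submodule.mem_span_singleton.1 hz2
        have := huF _ hz1
        simp only [map_smul, LinearMap.smul_apply, smul_eq_mul, mul_eq_zero, hxu0, or_false] at this
        simp [this]
      rw [hinf, finrank_bot, finrank_span_singleton (by rintro rfl; simp at hxx)] at this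
      rw [hF'eq]; omega
    obtain ⟨l, hl, hl2, hl3⟩ := ih T' (by
        intro y z
        rw [T'app, T'app, reflpq_orth u huu, horth]) (by
        rw [← hF', hF'eq]
        intro z hz hz2
        obtain ⟨f, hf, w, hw, rfl⟩ := Submodule.mem_sup.1 hz
        obtain ⟨c, rfl⟩ := Submodule.mem_span_singleton.1 hw
        have h1 := hz2 x (Submodule.mem_sup_right (Submodule.mem_span_singleton_self x))
        rw [map_add, LinearMap.add_apply, Bpq_symm f x, hxF f hf] at h1
        simp only [map_smul, LinearMap.smul_apply, smul_eq_mul, zero_add, mul_eq_zero, hxx,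
          or_false] at h1
        subst h1
        simp only [zero_smul, add_zero] at hz2 ⊢
        exact hker f hf fun y hy => hz2 y (Submodule.mem_sup_left hy)) (by
        rw [← hF', hdim']; omega)
    refine ⟨u :: l, by simp [hl], ?_, ?_⟩
    · intro v hv
      rcases List.mem_cons.1 hv with rfl | hv
      · exact huu
      · exact hl2 v hv
    · rw [List.map_cons, List.foldr_cons, ← hl3]
      funext y
      simp only [Function.comp_apply]
      rw [T'app, reflpq_invol u huu]

/-- `T - 1` maps into the span of the reflection vectors. -/
lemma foldr_sub_mem (l : List (Fin (p + q) → ℝ)) (x : Fin (p + q) → ℝ) :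
    (l.map (reflpq p q)).foldr (· ∘ ·) id x - x ∈ Submodule.span ℝ {u | u ∈ l} := by
  induction l with
  | nil => simp
  | cons a l ih =>
    simp only [List.map_cons, List.foldr_cons, Function.comp_apply]
    set y := (l.map (reflpq p q)).foldr (· ∘ ·) id x
    have : reflpq p q a y - x = (y - x) - (2 * Bpq p q y a / Bpq p q a a) • a := by
      rw [reflpq]; abel
    rw [this]
    refine Submodule.sub_mem _ (Submodule.span_mono (by intro u; simp; tauto) ih)
      (Submodule.smul_mem _ _ (Submodule.subset_span (by simp)))

/-- Euler operator on the exterior algebra. -/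
noncomputable def eulerL (n : ℕ) :
    ExteriorAlgebra ℝ (Fin n → ℝ) →ₗ[ℝ] ExteriorAlgebra ℝ (Fin n → ℝ) :=
  ∑ i : Fin n, (LinearMap.mulLeft ℝ (ExteriorAlgebra.ι ℝ (Pi.single i (1 : ℝ) : Fin n → ℝ))).comp
    (CliffordAlgebra.contractLeft (Q := (0 : QuadraticForm ℝ (Fin n → ℝ)))
      (LinearMap.proj i : (Fin n → ℝ) →ₗ[ℝ] ℝ))

lemma eulerL_ι_mul {n : ℕ} (a : Fin n → ℝ) (Z : ExteriorAlgebra ℝ (Fin n → ℝ)) :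
    eulerL n (ExteriorAlgebra.ι ℝ a * Z) =
      ExteriorAlgebra.ι ℝ a * Z + ExteriorAlgebra.ι ℝ a * eulerL n Z := by
  simp only [eulerL, LinearMap.sum_apply, LinearMap.comp_apply, LinearMap.mulLeft_apply]
  have h1 : ∀ i : Fin n, ExteriorAlgebra.ι ℝ (Pi.single i (1 : ℝ) : Fin n → ℝ) *
      (CliffordAlgebra.contractLeft (Q := (0 : QuadraticForm ℝ (Fin n → ℝ)))
        (LinearMap.proj i : (Fin n → ℝ) →ₗ[ℝ] ℝ) (ExteriorAlgebra.ι ℝ a * Z)) =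
      (ExteriorAlgebra.ι ℝ (a i • (Pi.single i (1 : ℝ) : Fin n → ℝ))) * Z +
      ExteriorAlgebra.ι ℝ a * (ExteriorAlgebra.ι ℝ (Pi.single i (1 : ℝ) : Fin n → ℝ) *
        (CliffordAlgebra.contractLeft (Q := (0 : QuadraticForm ℝ (Fin n → ℝ)))
          (LinearMap.proj i : (Fin n → ℝ) →ₗ[ℝ] ℝ) Z)) := by
    intro i
    have := CliffordAlgebra.contractLeft_ι_mul (Q := (0 : QuadraticForm ℝ (Fin n → ℝ)))
      (d := (LinearMap.proj i : (Fin n → ℝ) →ₗ[ℝ] ℝ)) a Z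
    erw [this]
    have hsw := eq_neg_of_add_eq_zero_left
      (ExteriorAlgebra.ι_add_mul_swap (R := ℝ) (Pi.single i (1 : ℝ) : Fin n → ℝ) a)
    rw [mul_sub, ← mul_assoc (ExteriorAlgebra.ι ℝ a)]
    erw [← mul_assoc (ExteriorAlgebra.ι ℝ (Pi.single i (1 : ℝ) : Fin n → ℝ)) (ExteriorAlgebra.ι ℝ a)]
    rw [hsw, neg_mul, sub_neg_eq_add, map_smul, smul_mul_assoc, mul_smul_comm]
    rfl
  rw [Finset.sum_congr rfl fun i _ => h1 i, Finset.sum_add_distrib, ← Finset.sum_mul,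
    ← Finset.mul_sum, ← map_sum]
  congr 3
  funext j
  simp [Finset.sum_apply, Pi.single_apply]

lemma eulerL_one {n : ℕ} : eulerL n 1 = 0 := by
  simp only [eulerL, LinearMap.sum_apply, LinearMap.comp_apply, LinearMap.mulLeft_apply]
  refine Finset.sum_eq_zero fun i _ => ?_
  erw [CliffordAlgebra.contractLeft_one]
  simp

lemma eulerL_list {n : ℕ} (l : List (Fin n → ℝ)) :
    eulerL n (l.map (ExteriorAlgebra.ι ℝ)).prod =
      (l.length : ℝ) • (l.map (ExteriorAlgebra.ι ℝ)).prod := by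
  induction l with
  | nil => simp [eulerL_one]
  | cons a l ih =>
    rw [List.map_cons, List.prod_cons, eulerL_ι_mul, ih, mul_smul_comm, List.length_cons]
    push_cast
    rw [add_smul, one_smul, add_comm]

lemma ιMulti_eq_list {n m : ℕ} (v : Fin m → (Fin n → ℝ)) :
    ExteriorAlgebra.ιMulti ℝ m v = ((List.ofFn v).map (ExteriorAlgebra.ι ℝ)).prod := by
  rw [ExteriorAlgebra.ιMulti_apply, List.map_ofFn]; rfl

lemma eulerL_homog {n m : ℕ} (Y : ExteriorAlgebra ℝ (Fin n → ℝ)) (hY : Y ∈ ⋀[ℝ]^m (Fin n → ℝ)) :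
    eulerL n Y = (m : ℝ) • Y := by
  rw [← ExteriorAlgebra.ιMulti_span_fixedDegree] at hY
  induction hY using Submodule.span_induction with
  | mem x h =>
    obtain ⟨v, rfl⟩ := h
    rw [ιMulti_eq_list, eulerL_list]; simp
  | zero => simp
  | add x y _ _ hx hy => rw [map_add, hx, hy, smul_add]
  | smul a x _ hx => rw [map_smul, hx, smul_comm]

lemma eulerL_decompose {n : ℕ} (Y : ExteriorAlgebra ℝ (Fin n → ℝ)) (m : ℕ) :
    DirectSum.decompose (fun i : ℕ => ⋀[ℝ]^i (Fin n → ℝ)) (eulerL n Y) m =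
      (m : ℝ) • DirectSum.decompose (fun i : ℕ => ⋀[ℝ]^i (Fin n → ℝ)) Y m := by
  induction Y using DirectSum.Decomposition.inductionOn (fun i : ℕ => ⋀[ℝ]^i (Fin n → ℝ)) with
  | zero => simp
  | @homogeneous i y =>
    rw [eulerL_homog _ y.2, DirectSum.decompose_smul, DirectSum.smul_apply]
    by_cases h : i = m
    · subst h; rfl
    · have : DirectSum.decompose (fun i : ℕ => ⋀[ℝ]^i (Fin n → ℝ)) y m = 0 := by
        apply Subtype.ext
        exact DirectSum.decompose_of_mem_ne (fun i : ℕ => ⋀[ℝ]^i (Fin n → ℝ)) y.2 h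
      rw [this, smul_zero, smul_zero]
  | add x y hx hy =>
    rw [map_add, DirectSum.decompose_add, DirectSum.add_apply, hx, hy, DirectSum.decompose_add,
      DirectSum.add_apply, smul_add]

lemma scalar_of_contract {n : ℕ} (Y : ExteriorAlgebra ℝ (Fin n → ℝ))
    (h : ∀ d : Module.Dual ℝ (Fin n → ℝ),
      CliffordAlgebra.contractLeft (Q := (0 : QuadraticForm ℝ (Fin n → ℝ))) d Y = 0) :
    ∃ c : ℝ, Y = algebraMap ℝ _ c := by
  have hE : eulerL n Y = 0 := by
    simp only [eulerL, LinearMap.sum_apply, LinearMap.comp_apply, LinearMap.mulLeft_apply]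
    refine Finset.sum_eq_zero fun i _ => ?_
    erw [h]
    simp
  have hc : ∀ m : ℕ, m ≠ 0 →
      DirectSum.decompose (fun i : ℕ => ⋀[ℝ]^i (Fin n → ℝ)) Y m = 0 := by
    intro m hm
    have := eulerL_decompose Y m
    rw [hE, DirectSum.decompose_zero, DirectSum.zero_apply] at this
    have h2 := (smul_eq_zero.1 this.symm)
    rcases h2 with h2 | h2
    · exact absurd (by exact_mod_cast h2) hm
    · exact h2
  have hY : Y = (DirectSum.decompose (fun i : ℕ => ⋀[ℝ]^i (Fin n → ℝ)) Y 0 :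
      ExteriorAlgebra ℝ (Fin n → ℝ)) := by
    apply (DirectSum.decompose (fun i : ℕ => ⋀[ℝ]^i (Fin n → ℝ))).injective
    rw [DirectSum.decompose_coe]
    refine DFinsupp.ext fun m => ?_
    by_cases hm : m = 0
    · subst hm
      exact (DirectSum.of_eq_same (β := fun i : ℕ => ⋀[ℝ]^i (Fin n → ℝ)) _ _).symm
    · exact (hc m hm).trans
        (DirectSum.of_eq_of_ne (β := fun i : ℕ => ⋀[ℝ]^i (Fin n → ℝ)) _ _ _ hm).symm
  have h0 := (DirectSum.decompose (fun i : ℕ => ⋀[ℝ]^i (Fin n → ℝ)) Y 0).2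
  rw [← hY] at h0
  have h0' : Y ∈ (1 : Submodule ℝ (ExteriorAlgebra ℝ (Fin n → ℝ))) := by
    rw [← pow_zero (LinearMap.range (ExteriorAlgebra.ι ℝ : (Fin n → ℝ) →ₗ[ℝ] _))]
    exact h0
  obtain ⟨c, hc⟩ := Submodule.mem_one.1 h0'
  exact ⟨c, hc.symm⟩

/-- filtration: spans of products of fewer than `k` vectors -/
noncomputable def Fil (n k : ℕ) : Submodule ℝ (ExteriorAlgebra ℝ (Fin n → ℝ)) :=
  Submodule.span ℝ {Y | ∃ l : List (Fin n → ℝ), l.length < k ∧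
    Y = (l.map (ExteriorAlgebra.ι ℝ)).prod}

lemma Fil_mono {n k k' : ℕ} (h : k ≤ k') : Fil n k ≤ Fil n k' :=
  Submodule.span_mono (by rintro Y ⟨l, hl, rfl⟩; exact ⟨l, hl.trans_le h, rfl⟩)

lemma Fil_list {n k : ℕ} (l : List (Fin n → ℝ)) (hl : l.length < k) :
    (l.map (ExteriorAlgebra.ι ℝ)).prod ∈ Fil n k :=
  Submodule.subset_span ⟨l, hl, rfl⟩

lemma Fil_mul {n k : ℕ} (a : Fin n → ℝ) (Y : ExteriorAlgebra ℝ (Fin n → ℝ)) (hY : Y ∈ Fil n k) :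
    ExteriorAlgebra.ι ℝ a * Y ∈ Fil n (k + 1) := by
  induction hY using Submodule.span_induction with
  | mem x h =>
    obtain ⟨l, hl, rfl⟩ := h
    exact Fil_list (a :: l) (by simpa using hl)
  | zero => simp
  | add x y _ _ hx hy => rw [mul_add]; exact Submodule.add_mem _ hx hy
  | smul c x _ hx => rw [mul_smul_comm]; exact Submodule.smul_mem _ _ hx

lemma Fil_contract_list {n : ℕ} (d : Module.Dual ℝ (Fin n → ℝ)) (l : List (Fin n → ℝ)) :
    CliffordAlgebra.contractLeft (Q := (0 : QuadraticForm ℝ (Fin n → ℝ))) d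
      (l.map (ExteriorAlgebra.ι ℝ)).prod ∈ Fil n (l.length + 1) := by
  induction l with
  | nil =>
    rw [List.map_nil, List.prod_nil]
    erw [CliffordAlgebra.contractLeft_one]
    exact Submodule.zero_mem _
  | cons a l ih =>
    rw [List.map_cons, List.prod_cons]
    erw [CliffordAlgebra.contractLeft_ι_mul]
    refine Submodule.sub_mem _ (Submodule.smul_mem _ _ (Fil_list l (by simp))) ?_
    exact Fil_mul a _ ih

lemma Fil_contract {n k : ℕ} (d : Module.Dual ℝ (Fin n → ℝ))
    (Y : ExteriorAlgebra ℝ (Fin n → ℝ)) (hY : Y ∈ Fil n k) :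
    CliffordAlgebra.contractLeft (Q := (0 : QuadraticForm ℝ (Fin n → ℝ))) d Y ∈ Fil n k := by
  induction hY using Submodule.span_induction with
  | mem x h =>
    obtain ⟨l, hl, rfl⟩ := h
    exact Fil_mono hl (Fil_contract_list d l)
  | zero => rw [map_zero]; exact Submodule.zero_mem _
  | add x y _ _ hx hy => rw [map_add]; exact Submodule.add_mem _ hx hy
  | smul c x _ hx => rw [map_smul]; exact Submodule.smul_mem _ _ hx

lemma list_mem {n : ℕ} (l : List (Fin n → ℝ)) :
    (l.map (ExteriorAlgebra.ι ℝ)).prod ∈ ⋀[ℝ]^l.length (Fin n → ℝ) := by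
  rw [← ExteriorAlgebra.ιMulti_span_fixedDegree]
  refine Submodule.subset_span ⟨l.get, ?_⟩
  rw [ιMulti_eq_list, List.ofFn_get]

lemma Fil_decompose {n k : ℕ} (Y : ExteriorAlgebra ℝ (Fin n → ℝ)) (hY : Y ∈ Fil n k) (m : ℕ)
    (hm : k ≤ m) : DirectSum.decompose (fun i : ℕ => ⋀[ℝ]^i (Fin n → ℝ)) Y m = 0 := by
  induction hY using Submodule.span_induction with
  | mem x h =>
    obtain ⟨l, hl, rfl⟩ := h
    apply Subtype.ext
    exact DirectSum.decompose_of_mem_ne (fun i : ℕ => ⋀[ℝ]^i (Fin n → ℝ)) (list_mem l) (by omega)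
  | zero => simp
  | add x y _ _ hx hy => rw [DirectSum.decompose_add, DirectSum.add_apply, hx, hy, add_zero]
  | smul c x _ hx => rw [DirectSum.decompose_smul, DirectSum.smul_apply, hx, smul_zero]

lemma equivExterior_list {n : ℕ} (Q : QuadraticForm ℝ (Fin n → ℝ)) (l : List (Fin n → ℝ)) :
    CliffordAlgebra.equivExterior Q (l.map (CliffordAlgebra.ι Q)).prod -
      (l.map (ExteriorAlgebra.ι ℝ)).prod ∈ Fil n l.length := by
  induction l with
  | nil =>
    have : CliffordAlgebra.equivExterior Q 1 = 1 := CliffordAlgebra.changeForm_one CliffordAlgebra.changeForm.associated_neg_proof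
    simp [this]
  | cons a l ih =>
    rw [List.map_cons, List.prod_cons, List.map_cons, List.prod_cons]
    set X := (l.map (CliffordAlgebra.ι Q)).prod
    have h1 : CliffordAlgebra.equivExterior Q (CliffordAlgebra.ι Q a * X) =
      ExteriorAlgebra.ι ℝ a * CliffordAlgebra.equivExterior Q X -
      CliffordAlgebra.contractLeft (Q := (0 : QuadraticForm ℝ (Fin n → ℝ)))
        (QuadraticMap.associated (R := ℝ) (-Q) a) (CliffordAlgebra.equivExterior Q X) :=
      CliffordAlgebra.changeForm_ι_mul CliffordAlgebra.changeForm.associated_neg_proof a X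
    set Y := CliffordAlgebra.equivExterior Q X
    set w := (l.map (ExteriorAlgebra.ι ℝ)).prod
    rw [h1, sub_right_comm, ← mul_sub]
    refine Submodule.sub_mem _ (Fil_mul a _ ih) (Fil_contract _ _ ?_)
    have : Y = (Y - w) + w := by abel
    rw [this]
    exact Submodule.add_mem _ (Fil_mono (by simp) ih) (Fil_list l (by simp))

lemma wedge_ne_zero {n r : ℕ} (v : Fin r → (Fin n → ℝ)) (hv : LinearIndependent ℝ v) :
    ((List.ofFn v).map (ExteriorAlgebra.ι ℝ)).prod ≠ 0 := by
  have h := exteriorPower.ιMulti_family_linearIndependent_field (n := r) hv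
  have hne := h.ne_zero (Set.powersetCard.ofFinEmbEquiv 
    (OrderIso.refl (Fin r)).toOrderEmbedding)
  intro h0
  apply hne
  apply Subtype.ext
  simp only [exteriorPower.ιMulti_family, Equiv.symm_apply_apply]
  rw [exteriorPower.ιMulti_apply_coe, ιMulti_eq_list]
  exact h0

lemma hasGrade_of_indep (l : List (Fin (p + q) → ℝ)) (hl : LinearIndependent ℝ l.get) :
    HasGrade p q (l.map (CliffordAlgebra.ι (Qpq p q))).prod l.length := by
  have key := equivExterior_list (Qpq p q) l
  set w := (l.map (ExteriorAlgebra.ι ℝ)).prod with hw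
  have hd : ∀ m, l.length ≤ m → gradeComponent p q (l.map (CliffordAlgebra.ι (Qpq p q))).prod m =
      DirectSum.decompose (fun i : ℕ => ⋀[ℝ]^i (Fin (p + q) → ℝ)) w m := by
    intro m hm
    have h := Fil_decompose _ key m hm
    rw [DirectSum.decompose_sub, DirectSum.sub_apply, sub_eq_zero] at h
    exact h
  constructor
  · rw [hd _ le_rfl]
    intro h
    have h2 := DirectSum.decompose_of_mem_same (fun i : ℕ => ⋀[ℝ]^i (Fin (p + q) → ℝ)) (list_mem l)
    rw [← hw, h] at h2
    have h3 := wedge_ne_zero l.get hl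
    rw [List.ofFn_get] at h3
    exact h3 h2.symm
  · intro u hu
    rw [hd u hu.le]
    apply Subtype.ext
    exact DirectSum.decompose_of_mem_ne (fun i : ℕ => ⋀[ℝ]^i (Fin (p + q) → ℝ)) (list_mem l) (by omega)

/-! Clifford part -/

lemma polar_Qpq (v a : Fin (p + q) → ℝ) : QuadraticMap.polar (Qpq p q) v a = 2 * Bpq p q v a := by
  simp only [QuadraticMap.polar, Qpq, LinearMap.BilinMap.toQuadraticMap_apply, map_add,
    LinearMap.add_apply, Bpq_symm a v]
  ring

lemma comm_eq_contract (v : Fin (p + q) → ℝ) (X : CliffordAlgebra (Qpq p q)) :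
    CliffordAlgebra.ι (Qpq p q) v * X - CliffordAlgebra.involute X * CliffordAlgebra.ι (Qpq p q) v =
      CliffordAlgebra.contractLeft ((2 : ℝ) • Bpq p q v) X := by
  induction X using CliffordAlgebra.left_induction with
  | algebraMap r => 
    rw [CliffordAlgebra.contractLeft_algebraMap, AlgHom.commutes, Algebra.commutes, sub_self]
  | add x y hx hy => rw [map_add, map_add, ← hx, ← hy]; noncomm_ring
  | ι_mul x a hx =>
    rw [CliffordAlgebra.contractLeft_ι_mul, ← hx, map_mul, CliffordAlgebra.involute_ι]
    have h := CliffordAlgebra.ι_mul_ι_add_swap (Q := Qpq p q) v a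
    rw [polar_Qpq] at h
    have h2 : (((2 : ℝ) • Bpq p q v) a) • x = (CliffordAlgebra.ι (Qpq p q) v *
      CliffordAlgebra.ι (Qpq p q) a + CliffordAlgebra.ι (Qpq p q) a *
        CliffordAlgebra.ι (Qpq p q) v) * x := by
      rw [h, ← Algebra.smul_def]; rfl
    rw [h2]
    noncomm_ring

lemma scalar_of_comm (X : CliffordAlgebra (Qpq p q))
    (h : ∀ v, CliffordAlgebra.ι (Qpq p q) v * X =
      CliffordAlgebra.involute X * CliffordAlgebra.ι (Qpq p q) v) :
    ∃ c : ℝ, X = algebraMap ℝ _ c := by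
  obtain ⟨c, hc⟩ := scalar_of_contract (CliffordAlgebra.equivExterior (Qpq p q) X) (by
    intro d
    obtain ⟨v, hv⟩ : ∃ v, (2 : ℝ) • Bpq p q v = d := by
      refine ⟨(1 / 2 : ℝ) • ((Bpq p q).toDual Bpq_nondeg_s18).symm d, ?_⟩
      rw [map_smul, smul_smul]
      norm_num
      ext x
      simp [LinearMap.BilinForm.apply_toDual_symm_apply]
    have h1 : CliffordAlgebra.contractLeft d X = 0 := by
      rw [← hv, ← comm_eq_contract, h, sub_self]
    have h2 : CliffordAlgebra.equivExterior (Qpq p q) (CliffordAlgebra.contractLeft d X) =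
      CliffordAlgebra.contractLeft (Q := (0 : QuadraticForm ℝ (Fin (p + q) → ℝ))) d
        (CliffordAlgebra.equivExterior (Qpq p q) X) :=
      CliffordAlgebra.changeForm_contractLeft CliffordAlgebra.changeForm.associated_neg_proof d X
    rw [← h2, h1, map_zero])
  refine ⟨c, ?_⟩
  apply (CliffordAlgebra.equivExterior (Qpq p q)).injective
  rw [hc]
  exact (CliffordAlgebra.changeForm_algebraMap CliffordAlgebra.changeForm.associated_neg_proof c).symm

lemma refl_ι (s v : Fin (p + q) → ℝ) (hs : Bpq p q s s ≠ 0) :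
    CliffordAlgebra.ι (Qpq p q) (reflpq p q s v) * CliffordAlgebra.ι (Qpq p q) s =
      - (CliffordAlgebra.ι (Qpq p q) s * CliffordAlgebra.ι (Qpq p q) v) := by
  have h := CliffordAlgebra.ι_mul_ι_add_swap (Q := Qpq p q) v s
  rw [polar_Qpq] at h
  have hq : Qpq p q s = Bpq p q s s := rfl
  rw [reflpq, map_sub, map_smul, sub_mul, smul_mul_assoc, CliffordAlgebra.ι_sq_scalar, hq,
    Algebra.smul_def, ← map_mul (algebraMap ℝ (CliffordAlgebra (Qpq p q))), div_mul_cancel₀ _ hs, ← h]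
  abel

lemma foldr_ι (l : List (Fin (p + q) → ℝ)) (hl : ∀ u ∈ l, Bpq p q u u ≠ 0)
    (v : Fin (p + q) → ℝ) :
    CliffordAlgebra.ι (Qpq p q) ((l.map (reflpq p q)).foldr (· ∘ ·) id v) *
      (l.map (CliffordAlgebra.ι (Qpq p q))).prod =
    CliffordAlgebra.involute (l.map (CliffordAlgebra.ι (Qpq p q))).prod *
      CliffordAlgebra.ι (Qpq p q) v := by
  induction l with
  | nil => simp
  | cons a l ih =>
    have ih := ih fun u hu => hl u (by simp [hu])
    rw [List.map_cons, List.foldr_cons, List.map_cons, List.prod_cons, Function.comp_apply,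
      ← mul_assoc, refl_ι a _ (hl a (by simp)), neg_mul, mul_assoc, ih, map_mul,
      CliffordAlgebra.involute_ι]
    noncomm_ring

lemma prod_isUnit (l : List (Fin (p + q) → ℝ)) (hl : ∀ u ∈ l, Bpq p q u u ≠ 0) :
    IsUnit (l.map (CliffordAlgebra.ι (Qpq p q))).prod := by
  induction l with
  | nil => simp
  | cons a l ih =>
    rw [List.map_cons, List.prod_cons]
    exact (CliffordAlgebra.isUnit_ι_of_isUnit _ (isUnit_iff_ne_zero.2 (hl a (by simp)))).mul
      (ih fun u hu => hl u (by simp [hu]))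

lemma prod_eq_smul (l l' : List (Fin (p + q) → ℝ)) (hl : ∀ u ∈ l, Bpq p q u u ≠ 0)
    (hl' : ∀ u ∈ l', Bpq p q u u ≠ 0)
    (h : (l.map (reflpq p q)).foldr (· ∘ ·) id = (l'.map (reflpq p q)).foldr (· ∘ ·) id) :
    ∃ c : ℝ, (l.map (CliffordAlgebra.ι (Qpq p q))).prod =
      c • (l'.map (CliffordAlgebra.ι (Qpq p q))).prod := by
  obtain ⟨U, hU⟩ := prod_isUnit l' hl'
  have e1 := foldr_ι l hl
  have e2 := foldr_ι l' hl'
  rw [h] at e1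
  set A := (l.map (CliffordAlgebra.ι (Qpq p q))).prod
  rw [← hU] at e2 ⊢
  have hA : A = U * ((U⁻¹ : (CliffordAlgebra (Qpq p q))ˣ) * A) := by simp
  set X := ((U⁻¹ : (CliffordAlgebra (Qpq p q))ˣ) * A) with hX
  obtain ⟨c, hc⟩ := scalar_of_comm X (by
    intro v
    have hu : IsUnit (CliffordAlgebra.involute (U : CliffordAlgebra (Qpq p q))) := U.isUnit.map _
    apply hu.mul_left_cancel
    have h1 := e1 v
    rw [hA, ← mul_assoc, e2 v, map_mul] at h1
    rw [← mul_assoc, h1, mul_assoc])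
  exact ⟨c, by rw [hA, hc, ← Algebra.commutes, Algebra.smul_def]⟩

end helpers

/-- if `T = φ_{s_1} ∘ ⋯ ∘ φ_{s_k}`, the Clifford product
`ι s_1 ⋯ ι s_k` has grade `t`, and the restriction of `B` to `Ker (T - I)` is
nondegenerate, then `T` can be factored into exactly `t` hyperplane reflections and
`dim (Ker (T - I))^⊥ = t`. -/
theorem stmt_18 (p q k t : ℕ) (T : (Fin (p + q) → ℝ) →ₗ[ℝ] (Fin (p + q) → ℝ))
    (horth : ∀ x y : Fin (p + q) → ℝ, Bpq p q (T x) (T y) = Bpq p q x y)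
    (s : Fin k → (Fin (p + q) → ℝ))
    (hs : ∀ i, Bpq p q (s i) (s i) ≠ 0)
    (hT : ⇑T = (List.ofFn fun i => reflpq p q (s i)).foldr (· ∘ ·) id)
    (hgr : HasGrade p q ((List.ofFn fun i => CliffordAlgebra.ι (Qpq p q) (s i)).prod) t)
    (hker : ∀ x ∈ LinearMap.ker (T - LinearMap.id),
      (∀ y ∈ LinearMap.ker (T - LinearMap.id), Bpq p q x y = 0) → x = 0) :
    (∃ u : Fin t → (Fin (p + q) → ℝ),
      (∀ i, Bpq p q (u i) (u i) ≠ 0) ∧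
      ⇑T = (List.ofFn fun i => reflpq p q (u i)).foldr (· ∘ ·) id) ∧
    Module.finrank ℝ ((Bpq p q).orthogonal (LinearMap.ker (T - LinearMap.id))) = t := by
  set F := LinearMap.ker (T - LinearMap.id) with hF
  have hFle : Module.finrank ℝ F ≤ p + q := by
    simpa using Submodule.finrank_le F
  obtain ⟨l, hlen, hl, hTl⟩ := exists_factor (p + q - Module.finrank ℝ F) T horth hker
    (by rw [← hF]; omega)
  have hrank := LinearMap.finrank_range_add_finrank_ker (T - LinearMap.id)
  rw [← hF, Module.finrank_fin_fun] at hrank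
  have hind : LinearIndependent ℝ l.get := by
    rw [linearIndependent_iff_card_le_finrank_span, Fintype.card_fin, Set.finrank]
    have hle : LinearMap.range (T - LinearMap.id) ≤ Submodule.span ℝ (Set.range l.get) := by
      rintro _ ⟨x, rfl⟩
      have h1 := foldr_sub_mem l x
      rw [← hTl] at h1
      rw [Set.range_list_get]
      exact h1
    have := Submodule.finrank_mono hle
    omega
  have hgr2 := hasGrade_of_indep l hind
  obtain ⟨c, hc⟩ := prod_eq_smul (List.ofFn s) l
    (by intro u hu; obtain ⟨i, rfl⟩ := (List.mem_ofFn' _ _).1 hu; exact hs i) hl (by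
      rw [← hTl, hT, List.map_ofFn]; rfl)
  have e : (List.ofFn fun i => CliffordAlgebra.ι (Qpq p q) (s i)).prod =
      ((List.ofFn s).map (CliffordAlgebra.ι (Qpq p q))).prod := by
    rw [List.map_ofFn]; rfl
  rw [e, hc] at hgr
  have hsm : ∀ (A : CliffordAlgebra (Qpq p q)) (m : ℕ),
      gradeComponent p q (c • A) m = c • gradeComponent p q A m := by
    intro A m
    rw [gradeComponent, map_smul, DirectSum.decompose_smul, DirectSum.smul_apply]; rfl
  have hc0 : c ≠ 0 := by
    rintro rfl
    apply hgr.1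
    rw [hsm, zero_smul]
  have ht : l.length = t := by
    rcases lt_trichotomy l.length t with h | h | h
    · exact absurd (by rw [hsm, hgr2.2 t h, smul_zero]) hgr.1
    · exact h
    · have h1 := hgr.2 _ h
      rw [hsm] at h1
      exact absurd ((smul_eq_zero.1 h1).resolve_left hc0) hgr2.1
  subst ht
  refine ⟨⟨l.get, fun i => hl _ (List.get_mem l i), ?_⟩, ?_⟩
  · have : (List.ofFn fun i => reflpq p q (l.get i)) = l.map (reflpq p q) := by
      conv_rhs => rw [← List.ofFn_get l, List.map_ofFn]
      rfl
    rw [this, ← hTl]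
  · rw [LinearMap.BilinForm.finrank_orthogonal Bpq_nondeg_s18, Module.finrank_fin_fun, hlen]
end
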